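/- arXiv:2103.01144 — 9 statements merged into one kernel-verified Lean document; each statement's English description precedes it below -/
import Mathlib

section
/- Let f : (0,∞) → (0,∞) be a function such that lim_{R→∞} (1/R)·log f(R) = h for some h ∈ (0,∞). Then for every ε > 0 and every δ > 0 there exists a sequence (R_n) of positive real numbers tending to +∞ such that lim_{n→∞} (f(R_n + δ) − f(R_n)) / e^{(h−ε)·R_n} = +∞. -/
open Filter

theorem aux_growth (f : ℝ → ℝ) (hf : ∀ R : ℝ, 0 < R → 0 < f R) (h : ℝ)
    (hlim : Tendsto (fun R : ℝ => Real.log (f R) / R) atTop (nhds h))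
    (e : ℝ) (he : 0 < e) (heh : e < h) (δ : ℝ) (hδ : 0 < δ) (N : ℝ) (hN : 0 < N) :
    ∃ R : ℝ, N ≤ R ∧ N * Real.exp ((h - e) * R) ≤ f (R + δ) - f R := by
  by_contra! hc
  set a := h - e with ha
  have hE : 0 < Real.exp (a * δ) - 1 := by
    have : 1 < Real.exp (a * δ) := Real.one_lt_exp_iff.2 (mul_pos (by linarith) hδ)
    linarith
  set C := N / (Real.exp (a * δ) - 1) with hC
  have hCN : C * (Real.exp (a * δ) - 1) = N := div_mul_cancel₀ _ hE.ne'
  set G := f N - C * Real.exp (a * N) with hG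
  have key : ∀ k : ℕ, f (N + k * δ) - C * Real.exp (a * (N + k * δ)) ≤ G := by
    intro k
    induction k with
    | zero => simp [hG]
    | succ k ih =>
      have hk : (0 : ℝ) ≤ k * δ := by positivity
      have h1 := hc (N + k * δ) (by linarith)
      have h2 : N + ((k + 1 : ℕ) : ℝ) * δ = N + k * δ + δ := by push_cast; ring
      have h3 : Real.exp (a * (N + k * δ + δ))
          = Real.exp (a * (N + k * δ)) * Real.exp (a * δ) := by
        rw [← Real.exp_add]; ring_nf
      rw [h2, h3]
      have h9 : N * Real.exp (a * (N + k * δ))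
          = C * (Real.exp (a * δ) - 1) * Real.exp (a * (N + k * δ)) := by rw [hCN]
      rw [h9] at h1
      linarith
  have hR : Tendsto (fun k : ℕ => N + (k : ℝ) * δ) atTop atTop :=
    tendsto_atTop_add_const_left _ _ (tendsto_natCast_atTop_atTop.atTop_mul_const hδ)
  have e1 : ∀ᶠ R : ℝ in atTop, h - e / 2 < Real.log (f R) / R :=
    hlim.eventually (lt_mem_nhds (by linarith))
  have e2 : ∀ᶠ R : ℝ in atTop, C + |G| < Real.exp (e / 2 * R) :=
    (Real.tendsto_exp_atTop.comp
      (tendsto_id.const_mul_atTop (half_pos he))).eventually_gt_atTop _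
  obtain ⟨k, ⟨k1, k2⟩, k3⟩ := (hR.eventually ((e1.and e2).and (eventually_gt_atTop 0))).exists
  have hk := key k
  generalize N + (k : ℝ) * δ = R at *
  rw [lt_div_iff₀ k3, Real.lt_log_iff_exp_lt (hf R k3)] at k1
  have h4 : Real.exp ((h - e / 2) * R) = Real.exp (a * R) * Real.exp (e / 2 * R) := by
    rw [← Real.exp_add, ha]; ring_nf
  have h5 : 1 ≤ Real.exp (a * R) := Real.one_le_exp (mul_nonneg (by linarith) k3.le)
  have h6 := mul_lt_mul_of_pos_left k2 (Real.exp_pos (a * R))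
  have h7 := mul_le_mul_of_nonneg_right h5 (abs_nonneg G)
  have h8 := le_abs_self G
  rw [h4] at k1
  linarith

/-- If `f : (0,∞) → (0,∞)` satisfies `lim_{R→∞} (1/R)·log f(R) = h` with `h ∈ (0,∞)`,
then for every `ε > 0` and `δ > 0` there is a sequence `Rₙ → ∞` of positive reals with
`(f(Rₙ + δ) − f(Rₙ)) / e^{(h−ε)·Rₙ} → +∞`. -/
theorem exists_seq_growth (f : ℝ → ℝ) (hf : ∀ R : ℝ, 0 < R → 0 < f R)
    (h : ℝ) (hh : 0 < h)
    (hlim : Tendsto (fun R : ℝ => Real.log (f R) / R) atTop (nhds h)) :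
    ∀ ε > (0 : ℝ), ∀ δ > (0 : ℝ), ∃ R : ℕ → ℝ,
      (∀ n, 0 < R n) ∧ Tendsto R atTop atTop ∧
      Tendsto (fun n => (f (R n + δ) - f (R n)) / Real.exp ((h - ε) * R n)) atTop atTop := by
  intro ε hε δ hδ
  have he : 0 < min ε (h / 2) := lt_min hε (by linarith)
  have heh : min ε (h / 2) < h := (min_le_right _ _).trans_lt (by linarith)
  choose R hR1 hR2 using fun n : ℕ =>
    aux_growth f hf h hlim _ he heh δ hδ ((n : ℝ) + 1) (by positivity)
  have hpos : ∀ n, 0 < R n := fun n => lt_of_lt_of_le (by positivity) (hR1 n)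
  have hT : Tendsto (fun n : ℕ => (n : ℝ) + 1) atTop atTop :=
    tendsto_atTop_add_const_right _ _ tendsto_natCast_atTop_atTop
  refine ⟨R, hpos, tendsto_atTop_mono hR1 hT, tendsto_atTop_mono (fun n => ?_) hT⟩
  rw [le_div_iff₀ (Real.exp_pos _)]
  refine le_trans ?_ (hR2 n)
  refine mul_le_mul_of_nonneg_left (Real.exp_le_exp.2 ?_) (by positivity)
  exact mul_le_mul_of_nonneg_right (by linarith [min_le_left ε (h / 2)]) (hpos n).le
end

section
/- Let σ : (0,∞) → ℝ be a function with lim_{R→∞} σ(R) = 0 and let δ > 0. Then limsup_{R→∞} R·(σ(R+δ) − σ(R)) ≥ 0; in particular this limsup, taken in the extended reals [−∞,+∞], is not negative and not −∞. -/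
open Filter

/-- If `σ : (0,∞) → ℝ` tends to `0` at `+∞` and `δ > 0`, then
`limsup_{R→∞} R·(σ(R+δ) − σ(R)) ≥ 0` in the extended reals `[−∞,+∞]`. -/
theorem limsup_nonneg_of_tendsto_zero (σ : ℝ → ℝ)
    (hσ : Tendsto σ atTop (nhds 0)) (δ : ℝ) (hδ : 0 < δ) :
    (0 : EReal) ≤ limsup (fun R : ℝ => ((R * (σ (R + δ) - σ R) : ℝ) : EReal)) atTop := by
  by_contra hcon
  rw [not_le] at hcon
  obtain ⟨c, hc1, hc2⟩ := EReal.lt_iff_exists_real_btwn.1 hcon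
  have hc : c < 0 := by exact_mod_cast hc2
  have hev : ∀ᶠ R : ℝ in atTop, R * (σ (R + δ) - σ R) < c := by
    filter_upwards [eventually_lt_of_limsup_lt hc1] with R hR
    exact_mod_cast hR
  have hR : Tendsto (fun n : ℕ => ((n : ℝ) + 1) * δ) atTop atTop :=
    (tendsto_atTop_add_const_right _ 1 tendsto_natCast_atTop_atTop).atTop_mul_const hδ
  obtain ⟨N, hN⟩ := eventually_atTop.1 (hR.eventually hev)
  set S : ℕ → ℝ := fun n => ∑ i ∈ Finset.range n, 1 / ((i : ℝ) + 1) with hS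
  have hSt : Tendsto S atTop atTop := Real.tendsto_sum_range_one_div_nat_succ_atTop
  set g : ℕ → ℝ := fun n => σ (((n : ℝ) + 1) * δ) + (-c / δ) * S n with hg
  have hgt : Tendsto g atTop atTop :=
    (hσ.comp hR).add_atTop (hSt.const_mul_atTop (div_pos (neg_pos.2 hc) hδ))
  have hle : ∀ n, N ≤ n → g n ≤ g N := by
    intro n hn
    induction n, hn using Nat.le_induction with
    | base => exact le_rfl
    | succ n hn ih =>
      refine le_trans ?_ ih
      have h := hN n hn
      have hp : 0 < ((n : ℝ) + 1) * δ := by positivity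
      have h2 : σ (((n : ℝ) + 1) * δ + δ) - σ (((n : ℝ) + 1) * δ) < c / (((n : ℝ) + 1) * δ) := by
        rw [lt_div_iff₀ hp]; linarith
      have h3 : (((n + 1 : ℕ) : ℝ) + 1) * δ = ((n : ℝ) + 1) * δ + δ := by push_cast; ring
      have h4 : (-c / δ) * (1 / ((n : ℝ) + 1)) = -(c / (((n : ℝ) + 1) * δ)) := by
        field_simp
      have h5 : S (n + 1) = S n + 1 / ((n : ℝ) + 1) := Finset.sum_range_succ _ _
      simp only [hg]
      rw [h3, h5, mul_add, h4]
      linarith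
  obtain ⟨n, hn1, hn2⟩ := ((eventually_ge_atTop N).and (hgt.eventually_gt_atTop (g N))).exists
  exact absurd (hle n hn1) (not_le.2 hn2)
end

section
/- Let f : [0,∞) → (0,∞) be a continuous positive function. Then limsup_{T→∞} (1/T)·log ∫₀ᵀ f(t) dt ≤ max{ 0, limsup_{T→∞} (1/T)·log f(T) }, where both limsups are taken in the extended reals [−∞,+∞]. -/
open Filter

/-- For a continuous positive function `f : [0,∞) → (0,∞)`,
`limsup_{T→∞} (1/T)·log ∫₀ᵀ f(t) dt ≤ max{0, limsup_{T→∞} (1/T)·log f(T)}`,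
where both limsups are taken in the extended reals. -/
theorem limsup_log_integral_le (f : ℝ → ℝ)
    (hcont : ContinuousOn f (Set.Ici 0))
    (hpos : ∀ t : ℝ, 0 ≤ t → 0 < f t) :
    limsup (fun T : ℝ => ((Real.log (∫ t in (0:ℝ)..T, f t) / T : ℝ) : EReal)) atTop ≤
      max 0 (limsup (fun T : ℝ => ((Real.log (f T) / T : ℝ) : EReal)) atTop) := by
  have hint : ∀ a b : ℝ, 0 ≤ a → 0 ≤ b → IntervalIntegrable f MeasureTheory.volume a b := by
    intro a b ha hb
    apply ContinuousOn.intervalIntegrable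
    apply hcont.mono
    intro x hx
    exact le_trans (le_min ha hb) hx.1
  rw [← EReal.le_of_forall_lt_iff_le]
  intro c hc
  have hc0 : 0 < c := by exact_mod_cast lt_of_le_of_lt (le_max_left _ _) hc
  have hev := eventually_lt_of_limsup_lt (lt_of_le_of_lt (le_max_right _ _) hc)
  obtain ⟨A, hA⟩ := eventually_atTop.1 hev
  set B := max A 1 with hB
  have hB1 : 1 ≤ B := le_max_right _ _
  set K := ∫ t in (0:ℝ)..B, f t with hK
  have hK0 : 0 ≤ K := intervalIntegral.integral_nonneg (by linarith) fun t ht => (hpos t ht.1).le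
  have hfb : ∀ t, B ≤ t → f t ≤ Real.exp (c * t) := by
    intro t ht
    have h1 : Real.log (f t) / t < c := by
      exact_mod_cast hA t ((le_max_left _ _).trans ht)
    have ht0 : 0 < t := by linarith
    rw [div_lt_iff₀ ht0] at h1
    exact ((Real.log_lt_iff_lt_exp (hpos t ht0.le)).1 h1).le
  have key : ∀ T, max B K ≤ T → Real.log (∫ t in (0:ℝ)..T, f t) / T ≤
      Real.log 2 / T + Real.log T / T + c := by
    intro T hT
    have hTB : B ≤ T := (le_max_left _ _).trans hT
    have hTK : K ≤ T := (le_max_right _ _).trans hT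
    have hT0 : 0 < T := by linarith
    have hp : 0 < ∫ t in (0:ℝ)..T, f t :=
      intervalIntegral.intervalIntegral_pos_of_pos_on (hint 0 T le_rfl hT0.le)
        (fun x hx => hpos x hx.1.le) hT0
    have h2 : ∫ t in B..T, f t ≤ ∫ t in B..T, Real.exp (c * T) := by
      apply intervalIntegral.integral_mono_on hTB (hint B T (by linarith) hT0.le)
        intervalIntegrable_const
      intro x hx
      refine (hfb x hx.1).trans (Real.exp_le_exp.2 ?_)
      exact mul_le_mul_of_nonneg_left hx.2 hc0.le
    rw [intervalIntegral.integral_const, smul_eq_mul] at h2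
    have h3 := intervalIntegral.integral_add_adjacent_intervals
      (hint 0 B le_rfl (by linarith)) (hint B T (by linarith) hT0.le)
    have he : 1 ≤ Real.exp (c * T) := Real.one_le_exp (by positivity)
    have h4 : ∫ t in (0:ℝ)..T, f t ≤ 2 * T * Real.exp (c * T) := by
      rw [← h3]
      nlinarith
    have h5 := Real.log_le_log hp h4
    rw [Real.log_mul (by positivity) (by positivity), Real.log_mul (by positivity) (by positivity),
      Real.log_exp] at h5
    rw [div_le_iff₀ hT0]
    have : (Real.log 2 / T + Real.log T / T + c) * T = Real.log 2 + Real.log T + c * T := by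
      field_simp
    linarith
  have hlim : Tendsto (fun T : ℝ => Real.log 2 / T + Real.log T / T + c) atTop (nhds c) := by
    have h1 : Tendsto (fun T : ℝ => Real.log 2 / T) atTop (nhds 0) :=
      tendsto_const_nhds.div_atTop tendsto_id
    have h2 : Tendsto (fun T : ℝ => Real.log T / T) atTop (nhds 0) :=
      Real.isLittleO_log_id_atTop.tendsto_div_nhds_zero
    simpa using (h1.add h2).add_const c
  have hlim2 : Tendsto (fun T : ℝ => ((Real.log 2 / T + Real.log T / T + c : ℝ) : EReal)) atTop
      (nhds (c : EReal)) := (continuous_coe_real_ereal.tendsto c).comp hlim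
  rw [← hlim2.limsup_eq]
  refine limsup_le_limsup ?_
  filter_upwards [eventually_ge_atTop (max B K)] with T hT
  exact EReal.coe_le_coe_iff.2 (key T hT)
end

section
/- Let K ⊆ ℝ² be a compact convex set containing the origin. Then the area of the reflection body satisfies |conv(K ∪ (−K))| ≤ 4·|K|. -/
open MeasureTheory

namespace RB

open Set Pointwise

local notation "E2" => EuclideanSpace ℝ (Fin 2)

def T (K : Set E2) (x : E2) : Set (ℝ × E2) :=
  {q | q.1 ∈ Icc (0:ℝ) 1 ∧ q.2 ∈ (1 - q.1) • K ∧ q.2 - x ∈ q.1 • K}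

def S (K : Set E2) : Set (E2 × (ℝ × E2)) := {p | p.2 ∈ T K p.1}

lemma S_compact {K : Set E2} (hK : IsCompact K) : IsCompact (S K) := by
  have : S K = (fun p : ℝ × (E2 × E2) =>
      (((1 - p.1) • p.2.1 - p.1 • p.2.2, (p.1, (1 - p.1) • p.2.1)) : E2 × (ℝ × E2))) ''
      (Icc (0:ℝ) 1 ×ˢ (K ×ˢ K)) := by
    ext ⟨x, θ, z⟩
    constructor
    · rintro ⟨h1, ⟨a, ha, h2⟩, ⟨b, hb, h3⟩⟩
      refine ⟨(θ, (a, b)), ⟨h1, ha, hb⟩, ?_⟩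
      simp only at h2 h3
      simp only [Prod.mk.injEq, true_and]
      refine ⟨?_, h2⟩
      rw [h2, h3]; abel
    · rintro ⟨⟨t, a, b⟩, ⟨h1, ha, hb⟩, h⟩
      simp only [Prod.mk.injEq] at h h1 ha hb
      obtain ⟨hx, rfl, rfl⟩ := h
      refine ⟨h1, ⟨a, ha, rfl⟩, ⟨b, hb, ?_⟩⟩
      simp only
      rw [← hx]; abel
  rw [this]
  apply IsCompact.image (isCompact_Icc.prod (hK.prod hK))
  fun_prop

lemma T_compact {K : Set E2} (hK : IsCompact K) (x : E2) : IsCompact (T K x) := by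
  have h : IsClosed (T K x) :=
    (S_compact hK).isClosed.preimage (f := fun q : ℝ × E2 => (x, q)) (by fun_prop)
  refine ((S_compact hK).image continuous_snd).of_isClosed_subset h ?_
  intro q hq
  exact ⟨(x, q), hq, rfl⟩

lemma mem_hull {K : Set E2} (hconv : Convex ℝ K) (h0 : (0 : E2) ∈ K) {y : E2}
    (hy : y ∈ convexHull ℝ (K ∪ -K)) : ∃ q : ℝ × E2, q ∈ T K y := by
  rw [hconv.convexHull_union hconv.neg ⟨0, h0⟩ ⟨0, by simpa using h0⟩, mem_convexJoin] at hy
  obtain ⟨a, ha, b, hb, u, v, hu, hv, huv, rfl⟩ := hy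
  refine ⟨(v, u • a), ⟨hv, by linarith⟩, ?_, ?_⟩
  · have : 1 - v = u := by linarith
    simp only [this]
    exact smul_mem_smul_set ha
  · refine ⟨-b, hb, ?_⟩
    simp

lemma incl {K : Set E2} (hconv : Convex ℝ K) {y : E2} {q0 q : ℝ × E2} (h : q0 ∈ T K y)
    (hq : q ∈ T K 0) {l : ℝ} (hl0 : 0 ≤ l) (hl1 : l ≤ 1) :
    l • q0 + (1 - l) • q ∈ T K (l • y) := by
  obtain ⟨⟨a1, a2⟩, a3, a4⟩ := h
  obtain ⟨⟨b1, b2⟩, b3, b4⟩ := hq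
  have hl : 0 ≤ 1 - l := by linarith
  refine ⟨⟨?_, ?_⟩, ?_, ?_⟩
  · simp; positivity
  · simp; nlinarith
  · have e : 1 - (l • q0 + (1 - l) • q).1 = l * (1 - q0.1) + (1 - l) * (1 - q.1) := by
      simp; ring
    rw [e, hconv.add_smul (mul_nonneg hl0 (by linarith)) (mul_nonneg hl (by linarith)),
      mul_smul, mul_smul]
    exact add_mem_add (smul_mem_smul_set a3) (smul_mem_smul_set b3)
  · have e : (l • q0 + (1 - l) • q).1 = l * q0.1 + (1 - l) * q.1 := by simp
    have e2 : (l • q0 + (1 - l) • q).2 - l • y = l • (q0.2 - y) + (1 - l) • (q.2 - 0) := by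
      simp [smul_sub]; abel
    rw [e, e2, hconv.add_smul (mul_nonneg hl0 a1) (mul_nonneg hl b1), mul_smul, mul_smul]
    exact add_mem_add (smul_mem_smul_set a4) (smul_mem_smul_set b4)

lemma vol_T {K : Set E2} (hconv : Convex ℝ K) (h0 : (0 : E2) ∈ K) {y : E2}
    (hy : y ∈ convexHull ℝ (K ∪ -K)) {l : ℝ} (hl0 : 0 ≤ l) (hl1 : l ≤ 1) :
    ENNReal.ofReal ((1 - l) ^ 3) * volume (T K 0) ≤ volume (T K (l • y)) := by
  obtain ⟨q0, hq0⟩ := mem_hull hconv h0 hy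
  have h : (l • q0) +ᵥ ((1 - l) • T K 0) ⊆ T K (l • y) := by
    rintro _ ⟨_, ⟨q, hq, rfl⟩, rfl⟩
    exact incl hconv hq0 hq hl0 hl1
  refine le_trans (le_of_eq ?_) (measure_mono h)
  have hl : 0 ≤ 1 - l := by linarith
  rw [Measure.volume_eq_prod, measure_vadd, Measure.addHaar_smul]
  have : Module.finrank ℝ (ℝ × E2) = 3 := by simp
  rw [this, abs_of_nonneg (by positivity)]

lemma smul_vol (K : Set E2) {r : ℝ} : volume (r • K) = ENNReal.ofReal (r ^ 2) * volume K := by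
  rw [Measure.addHaar_smul]
  simp

lemma smul_sub_smul {K : Set E2} (hconv : Convex ℝ K) (h0 : (0 : E2) ∈ K) {r s : ℝ}
    (hr : 0 ≤ r) (hrs : r ≤ s) : r • K ⊆ s • K := by
  have : s = r + (s - r) := by ring
  rw [this, hconv.add_smul hr (by linarith)]
  intro x hx
  rw [← add_zero x]
  exact add_mem_add hx ⟨0, h0, by simp⟩

lemma lint {a b : ℝ} (hab : a ≤ b) {f : ℝ → ℝ} (hf : Continuous f) (h : ∀ x ∈ Ioc a b, 0 ≤ f x) :
    ∫⁻ t in Ioc a b, ENNReal.ofReal (f t) = ENNReal.ofReal (∫ t in a..b, f t) := by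
  rw [intervalIntegral.integral_of_le hab, ofReal_integral_eq_lintegral_ofReal]
  · exact (hf.integrableOn_Icc).mono_set Ioc_subset_Icc_self
  · exact (ae_restrict_iff' measurableSet_Ioc).2 (Filter.Eventually.of_forall h)

lemma vol_T0 {K : Set E2} (hK : IsCompact K) (hconv : Convex ℝ K) (h0 : (0 : E2) ∈ K) :
    ENNReal.ofReal (1 / 12) * volume K ≤ volume (T K 0) := by
  rw [Measure.volume_eq_prod, Measure.prod_apply (T_compact hK 0).isClosed.measurableSet]
  have hd : Disjoint (Ioc (0:ℝ) (1/2)) (Ioc (1/2) 1) := by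
    rw [Set.disjoint_left]; intro x hx hy; exact absurd hx.2 (not_le.2 hy.1)
  refine le_trans ?_ (setLIntegral_le_lintegral (Ioc (0:ℝ) (1/2) ∪ Ioc (1/2) 1) _)
  rw [lintegral_union measurableSet_Ioc hd]
  have i1 : ∫⁻ t in Ioc (0:ℝ) (1/2), ENNReal.ofReal (t ^ 2) = ENNReal.ofReal (1/24) := by
    rw [lint (by norm_num) (by fun_prop) (fun x _ => by positivity)]
    congr 1; simp; norm_num
  have i2 : ∫⁻ t in Ioc (1/2:ℝ) 1, ENNReal.ofReal ((1 - t) ^ 2) = ENNReal.ofReal (1/24) := by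
    rw [lint (by norm_num) (by fun_prop) (fun x _ => by positivity)]
    congr 1
    rw [intervalIntegral.integral_comp_sub_left (fun t : ℝ => t ^ 2) 1]; simp; norm_num
  have e : ENNReal.ofReal (1 / 12) * volume K =
      ENNReal.ofReal (1/24) * volume K + ENNReal.ofReal (1/24) * volume K := by
    rw [← add_mul, ← ENNReal.ofReal_add (by norm_num) (by norm_num)]; norm_num
  rw [e]
  apply add_le_add
  · rw [← i1, ← lintegral_mul_const _ (by fun_prop)]
    refine setLIntegral_mono' measurableSet_Ioc fun t ht => ?_
    rw [← smul_vol]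
    refine measure_mono fun z hz => ⟨⟨ht.1.le, by linarith [ht.2]⟩, ?_, by simpa using hz⟩
    exact smul_sub_smul hconv h0 ht.1.le (by linarith [ht.2]) hz
  · rw [← i2, ← lintegral_mul_const _ (by fun_prop)]
    refine setLIntegral_mono' measurableSet_Ioc fun t ht => ?_
    rw [← smul_vol]
    refine measure_mono fun z hz => ⟨⟨by linarith [ht.1], ht.2⟩, hz, ?_⟩
    simp only [sub_zero]
    exact smul_sub_smul hconv h0 (by linarith [ht.2]) (by linarith [ht.1]) hz

lemma vol_S {K : Set E2} (hK : IsCompact K) :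
    ∫⁻ x, volume (T K x) ≤ ENNReal.ofReal (1 / 30) * (volume K * volume K) := by
  have hS := (S_compact hK).isClosed
  have e1 : ∀ x, volume (T K x) = ∫⁻ θ : ℝ, volume {z | (θ, z) ∈ T K x} := fun x => by
    rw [Measure.volume_eq_prod, Measure.prod_apply (T_compact hK x).isClosed.measurableSet]
    rfl
  simp_rw [e1]
  have hm : MeasurableSet {p : (E2 × ℝ) × E2 | (p.1.1, (p.1.2, p.2)) ∈ S K} :=
    (hS.preimage (f := fun p : (E2 × ℝ) × E2 => (p.1.1, (p.1.2, p.2)))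
      (by fun_prop)).measurableSet
  rw [lintegral_lintegral_swap (measurable_measure_prodMk_left hm).aemeasurable]
  have key : ∀ θ : ℝ, ∫⁻ x, volume {z | (θ, z) ∈ T K x} ≤
      (Icc (0:ℝ) 1).indicator
        (fun θ => ENNReal.ofReal ((1 - θ) ^ 2 * θ ^ 2) * (volume K * volume K)) θ := by
    intro θ
    by_cases hθ : θ ∈ Icc (0:ℝ) 1
    · rw [indicator_of_mem hθ]
      have hm2 : MeasurableSet {p : E2 × E2 | (p.1, (θ, p.2)) ∈ S K} :=
        (hS.preimage (f := fun p : E2 × E2 => (p.1, (θ, p.2))) (by fun_prop)).measurableSet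
      have a1 := Measure.prod_apply (μ := (volume : Measure E2)) (ν := (volume : Measure E2)) hm2
      have a2 := Measure.prod_apply_symm (μ := (volume : Measure E2))
        (ν := (volume : Measure E2)) hm2
      rw [a1] at a2
      refine (le_of_eq a2).trans ?_
      have b : ∀ z : E2, volume ((fun x => (x, z)) ⁻¹' {p : E2 × E2 | (p.1, (θ, p.2)) ∈ S K}) ≤
          ((1 - θ) • K).indicator (fun _ => ENNReal.ofReal (θ ^ 2) * volume K) z := by
        intro z
        by_cases hz : z ∈ (1 - θ) • K
        · rw [indicator_of_mem hz, ← smul_vol,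
            ← (Measure.measurePreserving_sub_left (volume : Measure E2) z).measure_preimage
              (hK.smul θ).isClosed.measurableSet.nullMeasurableSet]
          exact measure_mono fun x hx => hx.2.2
        · rw [indicator_of_notMem hz]
          refine (measure_mono_null (t := ∅) ?_ (by simp)).le
          intro x hx
          exact absurd hx.2.1 hz
      refine (lintegral_mono b).trans ?_
      rw [lintegral_indicator (hK.smul (1 - θ)).isClosed.measurableSet, setLIntegral_const,
        smul_vol, ENNReal.ofReal_mul (by positivity)]
      apply le_of_eq
      ring
    · rw [indicator_of_notMem hθ]
      apply le_of_eq
      rw [← lintegral_zero (μ := (volume : Measure E2))]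
      congr 1
      ext x
      refine measure_mono_null (t := ∅) ?_ (by simp)
      intro z hz
      exact absurd hz.1 hθ
  refine (lintegral_mono key).trans ?_
  rw [lintegral_indicator measurableSet_Icc, ← restrict_Ioc_eq_restrict_Icc,
    lintegral_mul_const _ (by fun_prop),
    lint (by norm_num) (by fun_prop) (fun x _ => by positivity)]
  apply le_of_eq
  congr 2
  have : ∀ x : ℝ, (1 - x) ^ 2 * x ^ 2 = x ^ 2 - 2 * x ^ 3 + x ^ 4 := fun x => by ring
  simp_rw [this]
  rw [intervalIntegral.integral_add, intervalIntegral.integral_sub]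
  · simp; norm_num
  all_goals exact Continuous.intervalIntegrable (by fun_prop) _ _

lemma layer {K : Set E2} (hK : IsCompact K) (hconv : Convex ℝ K) (h0 : (0 : E2) ∈ K)
    (hpos : volume (T K 0) ≠ 0) :
    volume (T K 0) * (ENNReal.ofReal (1 / 10) * volume (convexHull ℝ (K ∪ -K))) ≤
      ∫⁻ x, volume (T K x) := by
  have hfin : ∀ x, volume (T K x) ≠ ⊤ := fun x => (T_compact hK x).measure_lt_top.ne
  set c := (volume (T K 0)).toReal with hc
  have hc0 : 0 < c := ENNReal.toReal_pos hpos (hfin 0)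
  have hcc : volume (T K 0) = ENNReal.ofReal c := (ENNReal.ofReal_toReal (hfin 0)).symm
  have hmeas : Measurable fun x => volume (T K x) :=
    measurable_measure_prodMk_left (S_compact hK).isClosed.measurableSet
  have hmf : Measurable fun x => (volume (T K x)).toReal / c := hmeas.ennreal_toReal.div_const c
  have e : ∀ x, volume (T K x) =
      ENNReal.ofReal c * ENNReal.ofReal ((volume (T K x)).toReal / c) := fun x => by
    rw [← ENNReal.ofReal_mul hc0.le, mul_div_cancel₀ _ hc0.ne', ENNReal.ofReal_toReal (hfin x)]
  rw [lintegral_congr e, lintegral_const_mul _ hmf.ennreal_ofReal, hcc]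
  gcongr
  rw [lintegral_eq_lintegral_meas_le _ (Filter.Eventually.of_forall fun x => by positivity)
    hmf.aemeasurable]
  refine le_trans ?_ (lintegral_mono_set (s := Ioc (0:ℝ) 1) (fun t ht => ht.1))
  have i : ∫⁻ t in Ioc (0:ℝ) 1, ENNReal.ofReal ((1 - t ^ (1/3:ℝ)) ^ 2) = ENNReal.ofReal (1/10) := by
    rw [lint (by norm_num) _ (fun x _ => by positivity)]
    · congr 1
      have : EqOn (fun x : ℝ => (1 - x ^ (1/3:ℝ)) ^ 2)
          (fun x => 1 - 2 * x ^ (1/3:ℝ) + x ^ (2/3:ℝ)) (uIcc 0 1) := by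
        intro x hx
        rw [uIcc_of_le zero_le_one] at hx
        have : x ^ (2/3:ℝ) = (x ^ (1/3:ℝ)) ^ 2 := by
          rw [← Real.rpow_natCast, ← Real.rpow_mul hx.1]; norm_num
        simp only [this]; ring
      rw [intervalIntegral.integral_congr this, intervalIntegral.integral_add,
        intervalIntegral.integral_sub, intervalIntegral.integral_const_mul,
        integral_rpow (by norm_num), integral_rpow (by norm_num)]
      · norm_num
      all_goals apply Continuous.intervalIntegrable
      · fun_prop
      · exact continuous_const.mul (Real.continuous_rpow_const (by norm_num))
      · exact continuous_const.sub
          (continuous_const.mul (Real.continuous_rpow_const (by norm_num)))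
      · exact Real.continuous_rpow_const (by norm_num)
    · exact (continuous_const.sub (Real.continuous_rpow_const (by norm_num))).pow 2
  rw [← i, ← lintegral_mul_const _ (by fun_prop)]
  refine setLIntegral_mono' measurableSet_Ioc fun t ht => ?_
  rw [← smul_vol]
  apply measure_mono
  rintro _ ⟨y, hy, rfl⟩
  have r0 : 0 ≤ t ^ (1/3:ℝ) := Real.rpow_nonneg ht.1.le _
  have r1 : t ^ (1/3:ℝ) ≤ 1 := Real.rpow_le_one ht.1.le ht.2 (by norm_num)
  have r3 : (t ^ (1/3:ℝ)) ^ 3 = t := by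
    rw [← Real.rpow_natCast, ← Real.rpow_mul ht.1.le]; norm_num
  have := vol_T hconv h0 hy (l := 1 - t ^ (1/3:ℝ)) (by linarith) (by linarith)
  rw [sub_sub_cancel, r3, hcc, ← ENNReal.ofReal_mul ht.1.le,
    ENNReal.ofReal_le_iff_le_toReal (hfin _)] at this
  exact (le_div_iff₀ hc0).2 this

lemma degenerate {K : Set E2} (hconv : Convex ℝ K) (h : volume K = 0) (h0 : (0 : E2) ∈ K) :
    volume (convexHull ℝ (K ∪ -K)) = 0 := by
  have hi : ¬ (interior K).Nonempty := fun hn =>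
    (isOpen_interior.measure_pos volume hn).ne' (measure_mono_null interior_subset h)
  rw [hconv.interior_nonempty_iff_affineSpan_eq_top] at hi
  have hs : Submodule.span ℝ K ≠ ⊤ := by
    intro hs
    apply hi
    have e := affineSpan_insert_zero (k := ℝ) K
    rw [insert_eq_of_mem h0, hs] at e
    rw [← AffineSubspace.coe_eq_univ_iff, e]
    rfl
  refine measure_mono_null ?_ (Measure.addHaar_submodule volume _ hs)
  refine convexHull_min (union_subset Submodule.subset_span ?_) (Submodule.convex _)
  intro x hx
  have := Submodule.subset_span (R := ℝ) (s := K) hx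
  simpa using this

theorem main (K : Set (EuclideanSpace ℝ (Fin 2)))
    (hK : IsCompact K) (hconv : Convex ℝ K) (h0 : (0 : EuclideanSpace ℝ (Fin 2)) ∈ K) :
    volume (convexHull ℝ (K ∪ -K)) ≤ 4 * volume K := by
  by_cases h : volume K = 0
  · rw [RB.degenerate hconv h h0]; simp
  have hf : volume K ≠ ⊤ := hK.measure_lt_top.ne
  have h1 := RB.vol_T0 hK hconv h0
  have hne : volume (RB.T K 0) ≠ 0 := by
    intro h2
    rw [h2] at h1
    simp at h1
    exact h h1
  have h2 := (RB.layer hK hconv h0 hne).trans (RB.vol_S hK)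
  have h3 := (mul_le_mul_left h1 _).trans h2
  set V := volume (convexHull ℝ (K ∪ -K))
  have a : ENNReal.ofReal (1 / 12) * volume K * (ENNReal.ofReal (1 / 10) * V) =
      (ENNReal.ofReal (1 / 120) * volume K) * V := by
    have : ENNReal.ofReal (1 / 120) = ENNReal.ofReal (1/12) * ENNReal.ofReal (1/10) := by
      rw [← ENNReal.ofReal_mul (by norm_num)]; norm_num
    rw [this]; ring
  have b : ENNReal.ofReal (1 / 30) * (volume K * volume K) =
      (ENNReal.ofReal (1 / 120) * volume K) * (4 * volume K) := by
    have : ENNReal.ofReal (1 / 30) = ENNReal.ofReal (1/120) * 4 := by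
      rw [show (4 : ENNReal) = ENNReal.ofReal 4 by simp, ← ENNReal.ofReal_mul (by norm_num)]
      norm_num
    rw [this]; ring
  rw [a, b] at h3
  refine (ENNReal.mul_le_mul_iff_right ?_ ?_).1 h3
  · simp [h]
  · exact ENNReal.mul_ne_top ENNReal.ofReal_ne_top hf

end RB

/-- For a compact convex set `K ⊆ ℝ²` containing the origin, the area of the
reflection body satisfies `|conv(K ∪ (−K))| ≤ 4·|K|`. -/
theorem reflection_body_volume_le (K : Set (EuclideanSpace ℝ (Fin 2)))
    (hK : IsCompact K) (hconv : Convex ℝ K) (h0 : (0 : EuclideanSpace ℝ (Fin 2)) ∈ K) :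
    volume (convexHull ℝ (K ∪ -K)) ≤ 4 * volume K := by
  exact RB.main K hK hconv h0
end

section
/- Let K ⊆ ℝ² be a compact convex set with nonempty interior containing the origin. Then |conv(K ∪ (−K))| = 4·|K| if and only if K is a triangle with one vertex at the origin, i.e. if and only if there exist a, b ∈ ℝ² such that K = conv{0, a, b}. -/
open MeasureTheory

lemma rb_clm (φ : ℝ × ℝ →L[ℝ] ℝ) (z : ℝ × ℝ) : φ z = φ (1,0) * z.1 + φ (0,1) * z.2 := by
  have : z = z.1 • ((1:ℝ),(0:ℝ)) + z.2 • ((0:ℝ),(1:ℝ)) := by ext <;> simp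
  conv_lhs => rw [this]
  rw [map_add, map_smul, map_smul]; simp only [smul_eq_mul]; ring

lemma rb_hull_sub (K : Set (ℝ × ℝ)) (hK : IsCompact K) (hc : Convex ℝ K)
    (n l : ℝ × ℝ →L[ℝ] ℝ) (hn : ∀ x ∈ K, |n x| ≤ 1) (hl : ∀ x ∈ K, 0 ≤ l x)
    (p q : ℝ × ℝ) (hp : p ∈ K) (hq : q ∈ K) (hnp : n p = 1) (hnq : n q = -1)
    (hspan : ∀ φ : ℝ × ℝ →L[ℝ] ℝ, ∃ a b : ℝ, ∀ x, φ x = a * n x + b * l x) :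
    convexHull ℝ (K ∪ -K) ⊆ convexHull ℝ {p, q, -p, -q} ∪ K ∪ -K := by
  have key : ∀ z ∈ convexHull ℝ (K ∪ -K), |n z| ≤ 1 →
      ((1 + n z) * l p + (1 - n z) * l q) / 2 < l z → z ∈ K := by
    intro z hz hnz hlt
    by_contra hzK
    obtain ⟨φ, u, h1, h2⟩ := geometric_hahn_banach_closed_point hc hK.isClosed hzK
    obtain ⟨a, b, hab⟩ := hspan φ
    have hpu := h1 p hp
    have hqu := h1 q hq
    rw [hab, hnp] at hpu
    rw [hab, hnq] at hqu
    have hlp := hl p hp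
    have hlq := hl q hq
    obtain ⟨e1, e2⟩ := abs_le.1 hnz
    rcases le_or_gt 0 b with hb | hb
    · have hsub : convexHull ℝ (K ∪ -K) ⊆ {x | φ x < u} := by
        apply convexHull_min _ (convex_halfSpace_lt φ.toLinearMap.isLinear u)
        rintro x (hx | hx)
        · exact h1 x hx
        · show φ x < u
          have hx' : -x ∈ K := hx
          have := hl _ hx'
          have h3 := hn _ hx'
          rw [map_neg] at this h3
          obtain ⟨e3, e4⟩ := abs_le.1 h3
          rw [hab]
          have : b * l x ≤ 0 := by nlinarith
          have := mul_nonneg hb hlp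
          have := mul_nonneg hb hlq
          rcases le_or_gt 0 a with ha | ha <;> nlinarith
      have := hsub hz
      simp only [Set.mem_ofPred_eq] at this
      linarith
    · rw [hab] at h2
      have h5 : b * l z ≤ b * (((1 + n z) * l p + (1 - n z) * l q) / 2) :=
        mul_le_mul_of_nonpos_left hlt.le hb.le
      have h3 : 0 ≤ (1 + n z) * (u - (a * 1 + b * l p)) := mul_nonneg (by linarith) (by linarith)
      have h4 : 0 ≤ (1 - n z) * (u - (a * (-1) + b * l q)) := mul_nonneg (by linarith) (by linarith)
      nlinarith
  have hsymm : ∀ z ∈ convexHull ℝ (K ∪ -K), -z ∈ convexHull ℝ (K ∪ -K) := by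
    intro z hz
    have : -convexHull ℝ (K ∪ -K) = convexHull ℝ (K ∪ -K) := by
      rw [← convexHull_neg]; congr 1; rw [Set.union_neg, neg_neg, Set.union_comm]
    rw [← this]; simpa using hz
  have hbd : ∀ z ∈ convexHull ℝ (K ∪ -K), n z ≤ 1 := by
    intro z hz
    have hsub : convexHull ℝ (K ∪ -K) ⊆ {x | n x ≤ 1} := by
      apply convexHull_min _ (convex_halfSpace_le n.toLinearMap.isLinear 1)
      rintro x (hx | hx)
      · exact (abs_le.1 (hn x hx)).2
      · have := (abs_le.1 (hn _ hx)).1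
        rw [map_neg] at this
        show n x ≤ 1
        linarith
    exact hsub hz
  intro z hz
  have hz' := hsymm z hz
  have a1 := hbd z hz
  have a2 := hbd _ hz'
  rw [map_neg] at a2
  have hnz : |n z| ≤ 1 := abs_le.2 ⟨by linarith, a1⟩
  by_cases c1 : ((1 + n z) * l p + (1 - n z) * l q) / 2 < l z
  · exact Or.inl (Or.inr (key z hz hnz c1))
  by_cases c2 : ((1 + n (-z)) * l p + (1 - n (-z)) * l q) / 2 < l (-z)
  · exact Or.inr (key _ hz' (by rwa [map_neg, abs_neg]) c2)
  refine Or.inl (Or.inl ?_)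
  by_contra hzP
  rw [map_neg, map_neg] at c2
  push Not at c1 c2
  have hclosed : IsClosed (convexHull ℝ ({p, q, -p, -q} : Set (ℝ × ℝ))) :=
    (Set.Finite.isCompact_convexHull ℝ (by simp)).isClosed
  obtain ⟨φ, u, h1, h2⟩ := geometric_hahn_banach_closed_point (convex_convexHull ℝ _) hclosed hzP
  obtain ⟨a, b, hab⟩ := hspan φ
  have b1 := h1 p (subset_convexHull ℝ _ (by simp))
  have b2 := h1 q (subset_convexHull ℝ _ (by simp))
  have b3 := h1 (-p) (subset_convexHull ℝ _ (by simp))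
  have b4 := h1 (-q) (subset_convexHull ℝ _ (by simp))
  rw [map_neg] at b3 b4
  rw [hab, hnp] at b1 b3
  rw [hab, hnq] at b2 b4
  rw [hab] at h2
  have e1 : 0 ≤ 1 + n z := by linarith
  have e2 : 0 ≤ 1 - n z := by linarith
  rcases le_or_gt 0 b with hb | hb
  · have h5 := mul_le_mul_of_nonneg_left c1 hb
    have h3 := mul_nonneg e1 (sub_nonneg.2 b1.le)
    have h4 := mul_nonneg e2 (sub_nonneg.2 b2.le)
    nlinarith
  · have h5 := mul_le_mul_of_nonpos_left c2 hb.le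
    have h3 := mul_nonneg e2 (sub_nonneg.2 b3.le)
    have h4 := mul_nonneg e1 (sub_nonneg.2 b4.le)
    nlinarith

lemma rb_std1 : volume (convexHull ℝ {((0:ℝ),(0:ℝ)), (1,0), (0,1)}) = ENNReal.ofReal (1/2) := by
  have hset : convexHull ℝ {((0:ℝ),(0:ℝ)), (1,0), (0,1)} = {z : ℝ × ℝ | 0 ≤ z.1 ∧ 0 ≤ z.2 ∧ z.1 + z.2 ≤ 1} := by
    apply Set.Subset.antisymm
    · apply convexHull_min
      · rintro z (rfl | rfl | rfl) <;> simp
      · rintro ⟨a, b⟩ ⟨h1, h2, h3⟩ ⟨c, d⟩ ⟨h4, h5, h6⟩ s t hs ht hst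
        simp only [Set.mem_ofPred_eq, Prod.smul_mk, Prod.mk_add_mk, smul_eq_mul] at *
        refine ⟨by positivity, by positivity, by nlinarith⟩
    · rintro ⟨a, b⟩ ⟨h1, h2, h3⟩
      simp only at h1 h2 h3
      rw [convexHull_insert (by simp), convexHull_pair]
      rw [mem_convexJoin]
      rcases eq_or_lt_of_le (add_nonneg h1 h2) with h | h
      · refine ⟨_, rfl, (1,0), left_mem_segment _ _ _, ?_⟩
        have : a = 0 := by linarith
        have : b = 0 := by linarith
        subst a b
        exact left_mem_segment _ _ _
      · refine ⟨_, rfl, (a/(a+b), b/(a+b)), ⟨a/(a+b), b/(a+b), by positivity, by positivity, by field_simp, by simp⟩, ?_⟩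
        refine ⟨1-(a+b), a+b, by linarith, by linarith, by ring, ?_⟩
        ext <;> simp <;> field_simp
  have hmeas : MeasurableSet (convexHull ℝ {((0:ℝ),(0:ℝ)), (1,0), (0,1)}) :=
    (Set.Finite.isCompact_convexHull ℝ (by simp)).measurableSet
  rw [Measure.volume_eq_prod, Measure.prod_apply hmeas, hset]
  have : ∀ x : ℝ, volume (Prod.mk x ⁻¹' {z : ℝ × ℝ | 0 ≤ z.1 ∧ 0 ≤ z.2 ∧ z.1 + z.2 ≤ 1}) =
      (Set.Icc (0:ℝ) 1).indicator (fun x => ENNReal.ofReal (1 - x)) x := by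
    intro x
    by_cases hx : x ∈ Set.Icc (0:ℝ) 1
    · rw [Set.indicator_of_mem hx]
      have : (Prod.mk x ⁻¹' {z : ℝ × ℝ | 0 ≤ z.1 ∧ 0 ≤ z.2 ∧ z.1 + z.2 ≤ 1}) = Set.Icc 0 (1-x) := by
        ext y
        simp only [Set.mem_preimage, Set.mem_ofPred_eq, Set.mem_Icc]
        exact ⟨fun h => ⟨h.2.1, by linarith⟩, fun h => ⟨hx.1, h.1, by linarith⟩⟩
      rw [this, Real.volume_Icc]; simp
    · rw [Set.indicator_of_notMem hx]
      have : (Prod.mk x ⁻¹' {z : ℝ × ℝ | 0 ≤ z.1 ∧ 0 ≤ z.2 ∧ z.1 + z.2 ≤ 1}) = ∅ := by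
        ext y
        simp only [Set.mem_preimage, Set.mem_ofPred_eq, Set.mem_empty_iff_false, iff_false]
        rintro ⟨h1, h2, h3⟩
        exact hx ⟨h1, by linarith⟩
      rw [this]; simp
  simp_rw [this]
  rw [lintegral_indicator measurableSet_Icc, ← ofReal_integral_eq_lintegral_ofReal]
  · rw [integral_Icc_eq_integral_Ioc, ← intervalIntegral.integral_of_le zero_le_one]
    congr 1
    rw [intervalIntegral.integral_sub (by simp) (by simp)]; simp; norm_num
  · exact (Continuous.continuousOn (by fun_prop)).integrableOn_Icc
  · filter_upwards [ae_restrict_mem measurableSet_Icc] with x hx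
    simpa using hx.2

lemma rb_std2 : volume (convexHull ℝ {((1:ℝ),(0:ℝ)), (0,1), (-1,0), (0,-1)}) = ENNReal.ofReal 2 := by
  have hset : convexHull ℝ {((1:ℝ),(0:ℝ)), (0,1), (-1,0), (0,-1)} = {z : ℝ × ℝ | |z.1| + |z.2| ≤ 1} := by
    apply Set.Subset.antisymm
    · apply convexHull_min
      · rintro z (rfl | rfl | rfl | rfl) <;> simp
      · rintro ⟨a, b⟩ h1 ⟨c, d⟩ h2 s t hs ht hst
        simp only [Set.mem_ofPred_eq, Prod.smul_mk, Prod.mk_add_mk, smul_eq_mul] at *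
        have i1 := abs_add_le (s*a) (t*c)
        have i2 := abs_add_le (s*b) (t*d)
        rw [abs_mul, abs_mul, abs_of_nonneg hs, abs_of_nonneg ht] at i1 i2
        nlinarith
    · rintro z hz
      simp only [Set.mem_ofPred_eq] at hz
      by_contra hzP
      obtain ⟨φ, u, h1, h2⟩ := geometric_hahn_banach_closed_point (convex_convexHull ℝ _) 
        (Set.Finite.isCompact_convexHull ℝ (by simp)).isClosed hzP
      have b1 := h1 (1,0) (subset_convexHull ℝ _ (by simp))
      have b2 := h1 (0,1) (subset_convexHull ℝ _ (by simp))
      have b3 := h1 (-1,0) (subset_convexHull ℝ _ (by simp))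
      have b4 := h1 (0,-1) (subset_convexHull ℝ _ (by simp))
      rw [rb_clm φ (-1, 0)] at b3
      rw [rb_clm φ (0, -1)] at b4
      rw [rb_clm] at h2
      simp only at b3 b4
      generalize φ (1,0) = A at *
      generalize φ (0,1) = B at *
      have i1 : A * z.1 ≤ u * |z.1| := by
        rcases abs_cases z.1 with h | h <;> rw [h.1] <;> nlinarith
      have i2 : B * z.2 ≤ u * |z.2| := by
        rcases abs_cases z.2 with h | h <;> rw [h.1] <;> nlinarith
      nlinarith
  have hmeas : MeasurableSet (convexHull ℝ {((1:ℝ),(0:ℝ)), (0,1), (-1,0), (0,-1)}) :=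
    (Set.Finite.isCompact_convexHull ℝ (by simp)).measurableSet
  rw [Measure.volume_eq_prod, Measure.prod_apply hmeas, hset]
  have : ∀ x : ℝ, volume (Prod.mk x ⁻¹' {z : ℝ × ℝ | |z.1| + |z.2| ≤ 1}) =
      (Set.Icc (-1:ℝ) 1).indicator (fun x => ENNReal.ofReal (2 * (1 - |x|))) x := by
    intro x
    have : (Prod.mk x ⁻¹' {z : ℝ × ℝ | |z.1| + |z.2| ≤ 1}) = Set.Icc (-(1-|x|)) (1-|x|) := by
      ext y
      simp only [Set.mem_preimage, Set.mem_ofPred_eq, Set.mem_Icc]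
      rw [← abs_le]; exact ⟨fun h => by linarith, fun h => by linarith⟩
    rw [this, Real.volume_Icc]
    by_cases hx : x ∈ Set.Icc (-1:ℝ) 1
    · rw [Set.indicator_of_mem hx]; congr 1; ring
    · rw [Set.indicator_of_notMem hx]
      have : ¬ |x| ≤ 1 := fun h => hx (abs_le.1 h)
      rw [ENNReal.ofReal_eq_zero]; linarith
  simp_rw [this]
  rw [lintegral_indicator measurableSet_Icc, ← ofReal_integral_eq_lintegral_ofReal]
  · rw [integral_Icc_eq_integral_Ioc, ← intervalIntegral.integral_of_le (by norm_num)]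
    congr 1
    have c : Continuous fun x : ℝ => 2 * (1 - |x|) := by fun_prop
    rw [← intervalIntegral.integral_add_adjacent_intervals (b := 0) (c.intervalIntegrable _ _) (c.intervalIntegrable _ _)]
    rw [intervalIntegral.integral_congr (g := fun x => 2 * (1 + x)), 
      intervalIntegral.integral_congr (a := 0) (g := fun x => 2 * (1 - x))]
    · rw [intervalIntegral.integral_const_mul, intervalIntegral.integral_const_mul, intervalIntegral.integral_add (by simp) (by simp),
        intervalIntegral.integral_sub (by simp) (by simp)]
      simp; norm_num
    · intro x hx
      rw [Set.uIcc_of_le (by norm_num)] at hx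
      simp only; rw [abs_of_nonneg hx.1]
    · intro x hx
      rw [Set.uIcc_of_le (by norm_num)] at hx
      simp only; rw [abs_of_nonpos hx.2]; ring
  · exact (Continuous.continuousOn (by fun_prop)).integrableOn_Icc
  · filter_upwards [ae_restrict_mem measurableSet_Icc] with x hx
    have := abs_le.2 hx
    simp only [Pi.zero_apply]; linarith

lemma rb_area (a b : ℝ × ℝ) : volume (convexHull ℝ {a, b, -a, -b}) = 4 * volume (convexHull ℝ {0, a, b}) := by
  let T : ℝ × ℝ →ₗ[ℝ] ℝ × ℝ :=
    (LinearMap.fst ℝ ℝ ℝ).smulRight a + (LinearMap.snd ℝ ℝ ℝ).smulRight b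
  have hT : ∀ z, T z = z.1 • a + z.2 • b := fun z => rfl
  have h1 : convexHull ℝ {0, a, b} = T '' convexHull ℝ {((0:ℝ),(0:ℝ)), (1,0), (0,1)} := by
    rw [T.image_convexHull]; simp [Set.image_insert_eq, hT]
  have h2 : convexHull ℝ {a, b, -a, -b} = T '' convexHull ℝ {((1:ℝ),(0:ℝ)), (0,1), (-1,0), (0,-1)} := by
    rw [T.image_convexHull]; simp [Set.image_insert_eq, hT]
  rw [h1, h2, Measure.addHaar_image_linearMap, Measure.addHaar_image_linearMap, rb_std1, rb_std2]
  rw [mul_left_comm]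
  congr 1
  rw [show (4 : ENNReal) = ENNReal.ofReal 4 by simp, ← ENNReal.ofReal_mul (by norm_num)]
  norm_num

lemma rb_conv_tr (K : Set (ℝ × ℝ)) (hc : Convex ℝ K) (w : ℝ × ℝ) :
    Convex ℝ ((fun k => k - w) '' K) := by
  rintro _ ⟨a, ha, rfl⟩ _ ⟨b, hb, rfl⟩ s t hs ht hst
  refine ⟨s • a + t • b, hc ha hb hs ht hst, ?_⟩
  have : s = 1 - t := by linarith
  subst this
  module

lemma rb_mem (K : Set (ℝ × ℝ)) (hc : Convex ℝ K) (hne : K.Nonempty) (x : ℝ × ℝ) :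
    x ∈ convexHull ℝ (K ∪ -K) ↔
      ∃ k1 ∈ K, ∃ k2 ∈ K, ∃ m ∈ Set.Icc (0:ℝ) 1, (1 - m) • k1 - m • k2 = x := by
  rw [convexHull_union hne hne.neg, hc.convexHull_eq, hc.neg.convexHull_eq, mem_convexJoin]
  constructor
  · rintro ⟨a, ha, b, hb, s, t, hs, ht, hst, rfl⟩
    refine ⟨a, ha, -b, hb, t, ⟨ht, by linarith⟩, ?_⟩
    rw [show 1 - t = s by linarith]; simp
  · rintro ⟨a, ha, b, hb, m, ⟨h0, h1⟩, rfl⟩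
    refine ⟨a, ha, -b, by simpa using hb, 1 - m, m, by linarith, h0, by ring, ?_⟩
    simp [sub_eq_add_neg]

lemma rb_compact (K : Set (ℝ × ℝ)) (hK : IsCompact K) (hc : Convex ℝ K) (hne : K.Nonempty) :
    IsCompact (convexHull ℝ (K ∪ -K)) := by
  have : convexHull ℝ (K ∪ -K) =
      (fun z : (ℝ × ℝ) × (ℝ × ℝ) × ℝ => (1 - z.2.2) • z.1 - z.2.2 • z.2.1) ''
        (K ×ˢ (K ×ˢ Set.Icc (0:ℝ) 1)) := by
    ext x
    rw [rb_mem K hc hne]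
    constructor
    · rintro ⟨a, ha, b, hb, m, hm, rfl⟩
      exact ⟨(a, b, m), ⟨ha, hb, hm⟩, rfl⟩
    · rintro ⟨⟨a, b, m⟩, ⟨ha, hb, hm⟩, rfl⟩
      exact ⟨a, ha, b, hb, m, hm, rfl⟩
  rw [this]
  exact (hK.prod (hK.prod isCompact_Icc)).image (by fun_prop)

lemma rb_exists_n (K : Set (ℝ × ℝ)) (hK : IsCompact K) (hne : K.Nonempty) :
    ∃ n : ℝ × ℝ →L[ℝ] ℝ, n ≠ 0 ∧ ∃ p ∈ K, ∃ q ∈ K, n q = - n p ∧ ∀ x ∈ K, |n x| ≤ n p := by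
  let f : ℝ → (ℝ × ℝ) → ℝ := fun θ z => Real.cos θ * z.1 + Real.sin θ * z.2
  have hf : Continuous (fun z : ℝ × (ℝ × ℝ) => f z.1 z.2) := by fun_prop
  have hf' : Continuous (fun z : ℝ × (ℝ × ℝ) => - f z.1 z.2) := by fun_prop
  let F : ℝ → ℝ := fun θ => sSup (f θ '' K) - sSup ((fun z => - f θ z) '' K)
  have hF : Continuous F :=
    (hK.continuous_sSup (f := f) hf).sub (hK.continuous_sSup (f := fun θ z => - f θ z) hf')
  have hFpi : F Real.pi = - F 0 := by
    simp [F, f]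
  have h0 : ∃ θ, F θ = 0 := by
    have := intermediate_value_uIcc (a := 0) (b := Real.pi) hF.continuousOn
    have h : (0:ℝ) ∈ Set.uIcc (F 0) (F Real.pi) := by
      rw [hFpi, Set.mem_uIcc]
      rcases le_total 0 (F 0) with h | h
      · right; constructor <;> linarith
      · left; constructor <;> linarith
    obtain ⟨θ, -, h⟩ := this h
    exact ⟨θ, h⟩
  obtain ⟨θ, hθ⟩ := h0
  have hc1 : ContinuousOn (f θ) K := Continuous.continuousOn (by fun_prop)
  obtain ⟨p, hp, hp1⟩ := hK.exists_sSup_image_eq hne hc1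
  obtain ⟨q, hq, hq1⟩ := hK.exists_sSup_image_eq hne hc1.neg
  have hp2 : ∀ x ∈ K, f θ x ≤ f θ p := by
    intro x hx; rw [← hp1]
    exact le_csSup (hK.image_of_continuousOn hc1).bddAbove ⟨x, hx, rfl⟩
  have hq2 : ∀ x ∈ K, - f θ x ≤ - f θ q := by
    intro x hx
    have := le_csSup (hK.image_of_continuousOn hc1.neg).bddAbove ⟨x, hx, rfl⟩
    rw [hq1] at this
    exact this
  have hpq : f θ p = - f θ q := by
    have h : sSup (f θ '' K) - sSup ((fun z => - f θ z) '' K) = 0 := hθ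
    have h' : sSup ((fun z => - f θ z) '' K) = - f θ q := hq1
    rw [hp1, h'] at h; linarith
  refine ⟨Real.cos θ • ContinuousLinearMap.fst ℝ ℝ ℝ + Real.sin θ • ContinuousLinearMap.snd ℝ ℝ ℝ,
    ?_, p, hp, q, hq, ?_, ?_⟩
  · intro h
    have e1 := congrArg (fun g : ℝ × ℝ →L[ℝ] ℝ => g (1,0)) h
    have e2 := congrArg (fun g : ℝ × ℝ →L[ℝ] ℝ => g (0,1)) h
    simp at e1 e2
    have := Real.sin_sq_add_cos_sq θ
    rw [e1, e2] at this; norm_num at this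
  · show f θ q = - f θ p
    linarith
  · intro x hx
    show |f θ x| ≤ f θ p
    rw [abs_le]
    constructor
    · linarith [hq2 x hx]
    · exact hp2 x hx

lemma rb_zero_of_interior (K : Set (ℝ × ℝ)) (x0 : ℝ × ℝ) (h : x0 ∈ interior K) (n : ℝ × ℝ →L[ℝ] ℝ)
    (hn : ∀ x ∈ K, n x ≤ n x0) : n = 0 := by
  by_contra hne
  have : ∃ v, 0 < n v := by
    by_contra! hcon
    apply hne
    ext v <;> simp
    · have := hcon (1,0); have := hcon (-(1,0)); rw [map_neg] at this; linarith
    · have := hcon (0,1); have := hcon (-(0,1)); rw [map_neg] at this; linarith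
  obtain ⟨v, hv⟩ := this
  have hcont : Continuous (fun t : ℝ => x0 + t • v) := by fun_prop
  have hev : ∀ᶠ t in nhds (0:ℝ), x0 + t • v ∈ K := by
    apply hcont.continuousAt.eventually
    simpa using mem_interior_iff_mem_nhds.1 h
  obtain ⟨ε, hε, hb⟩ := Metric.eventually_nhds_iff.1 hev
  have := hn _ (hb (y := ε/2) (by rw [Real.dist_eq, sub_zero, abs_of_pos (by positivity)]; linarith))
  rw [map_add, map_smul, smul_eq_mul] at this
  nlinarith

lemma rb_boundary (K : Set (ℝ × ℝ)) (hK : IsCompact K) (hc : Convex ℝ K) (hint : (interior K).Nonempty)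
    (h0 : (0 : ℝ × ℝ) ∈ K) (h0' : (0 : ℝ × ℝ) ∉ interior K) :
    volume (convexHull ℝ (K ∪ -K)) ≤ 4 * volume K ∧
    (volume (convexHull ℝ (K ∪ -K)) = 4 * volume K → ∃ a b : ℝ × ℝ, K = convexHull ℝ {0, a, b}) := by
  have hcl : closure (interior K) = K := by
    rw [hc.closure_interior_eq_closure_of_nonempty_interior hint, hK.isClosed.closure_eq]
  obtain ⟨x0, hx0⟩ := hint
  obtain ⟨l', hl'⟩ := geometric_hahn_banach_open_point hc.interior isOpen_interior h0'
  obtain ⟨l, hll⟩ : ∃ l, l = -l' := ⟨_, rfl⟩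
  have hl : ∀ x ∈ K, 0 ≤ l x := by
    have : K ⊆ {x | 0 ≤ l x} := by
      rw [← hcl]
      apply closure_minimal _ (isClosed_le continuous_const l.continuous)
      intro x hx
      have := hl' x hx
      rw [map_zero] at this
      simp [hll]; linarith
    exact this
  have hl0 : 0 < l x0 := by
    have := hl' x0 hx0
    rw [map_zero] at this
    simp [hll]; linarith
  obtain ⟨n', hn0, p, hp, q, hq, hqp, hn'⟩ := rb_exists_n K hK ⟨0, h0⟩
  have hpos : 0 < n' p := by
    rcases lt_or_eq_of_le ((abs_nonneg _).trans (hn' 0 h0)) with h | h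
    · exact h
    · exfalso
      apply hn0
      have hz : ∀ x ∈ K, n' x = 0 := fun x hx => by
        have := hn' x hx; rw [← h] at this; exact abs_nonpos_iff.1 this
      apply rb_zero_of_interior K x0 hx0
      intro x hx; rw [hz x hx, hz x0 (interior_subset hx0)]
  obtain ⟨n, hnn⟩ : ∃ n, n = (n' p)⁻¹ • n' := ⟨_, rfl⟩
  have hnx : ∀ x, n x = n' x / n' p := fun x => by
    rw [hnn]; simp; field_simp
  have hnp : n p = 1 := by rw [hnx]; field_simp
  have hnq : n q = -1 := by rw [hnx, hqp]; field_simp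
  have hn : ∀ x ∈ K, |n x| ≤ 1 := fun x hx => by
    rw [hnx, abs_div, abs_of_pos hpos, div_le_one hpos]; exact hn' x hx
  have hspan : ∀ φ : ℝ × ℝ →L[ℝ] ℝ, ∃ a b : ℝ, ∀ x, φ x = a * n x + b * l x := by
    intro φ
    have hD : n (1,0) * l (0,1) - n (0,1) * l (1,0) ≠ 0 := by
      intro hD
      have hlp := hl p hp
      have hlq := hl q hq
      have e1 := rb_clm n p
      have e2 := rb_clm n q
      have e4 := rb_clm l p
      have e5 := rb_clm l q
      have e6 := rb_clm l x0
      rw [hnp] at e1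
      rw [hnq] at e2
      have f1 : l (1,0) = n (1,0) * l p := by
        rw [e4]; linear_combination (l (1,0)) * e1 - p.2 * hD
      have f2 : l (0,1) = n (0,1) * l p := by
        rw [e4]; linear_combination (l (0,1)) * e1 + p.1 * hD
      have f3 : l q = - l p := by
        rw [e5, f1, f2]; linear_combination (-l p) * e2
      have f4 : l p = 0 := by linarith
      rw [e6, f1, f2, f4] at hl0
      simp at hl0
    refine ⟨(φ (1,0) * l (0,1) - φ (0,1) * l (1,0)) / (n (1,0) * l (0,1) - n (0,1) * l (1,0)),
      (n (1,0) * φ (0,1) - n (0,1) * φ (1,0)) / (n (1,0) * l (0,1) - n (0,1) * l (1,0)), fun x => ?_⟩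
    rw [rb_clm φ x, rb_clm n x, rb_clm l x]
    generalize hDD : n (1,0) * l (0,1) - n (0,1) * l (1,0) = D at *
    field_simp
    rw [← hDD]
    ring
  have hsub := rb_hull_sub K hK hc n l hn hl p q hp hq hnp hnq hspan
  have hΔK : convexHull ℝ {0, p, q} ⊆ K := by
    apply convexHull_min _ hc
    rintro x (rfl | rfl | rfl) <;> assumption
  have hΔP : convexHull ℝ {0, p, q} ⊆ convexHull ℝ {p, q, -p, -q} := by
    apply convexHull_min _ (convex_convexHull ℝ _)
    rintro x (rfl | rfl | rfl)
    · have := (convex_convexHull ℝ {p, q, -p, -q}) (subset_convexHull ℝ _ (show p ∈ _ by simp))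
        (subset_convexHull ℝ _ (show -p ∈ _ by simp)) (show (0:ℝ) ≤ 1/2 by norm_num)
        (show (0:ℝ) ≤ 1/2 by norm_num) (by norm_num)
      simpa using this
    · exact subset_convexHull ℝ _ (by simp)
    · exact subset_convexHull ℝ _ (by simp)
  have hPneg : ∀ x, -x ∈ convexHull ℝ {p, q, -p, -q} → x ∈ convexHull ℝ {p, q, -p, -q} := by
    intro x hx
    have : -convexHull ℝ {p, q, -p, -q} = convexHull ℝ {p, q, -p, -q} := by
      rw [← convexHull_neg]; congr 1; ext y
      simp [Set.mem_neg, neg_eq_iff_eq_neg]; tauto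
    rw [← this]; exact hx
  set Δ := convexHull ℝ {0, p, q} with hΔ
  have hΔm : IsCompact Δ := Set.Finite.isCompact_convexHull ℝ (by simp)
  have hle : volume (convexHull ℝ (K ∪ -K)) ≤ 4 * volume Δ + 2 * volume (K \ Δ) := by
    have hs2 : convexHull ℝ (K ∪ -K) ⊆ convexHull ℝ {p, q, -p, -q} ∪ ((K \ Δ) ∪ -(K \ Δ)) := by
      intro z hz
      by_cases hzP : z ∈ convexHull ℝ {p, q, -p, -q}
      · exact Or.inl hzP
      · rcases hsub hz with (h | h) | h
        · exact absurd h hzP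
        · exact Or.inr (Or.inl ⟨h, fun h' => hzP (hΔP h')⟩)
        · exact Or.inr (Or.inr ⟨h, fun h' => hzP (hPneg z (hΔP h'))⟩)
    calc volume (convexHull ℝ (K ∪ -K)) ≤ _ := measure_mono hs2
      _ ≤ _ := measure_union_le _ _
      _ ≤ _ := add_le_add le_rfl (measure_union_le _ _)
      _ = _ := by rw [Measure.measure_neg, rb_area, two_mul]
  have hKeq : volume K = volume Δ + volume (K \ Δ) := by
    rw [← measure_inter_add_sdiff K hΔm.measurableSet, Set.inter_eq_right.2 hΔK]
  have hfin : volume K ≠ ⊤ := hK.measure_lt_top.ne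
  have hf1 : volume Δ ≠ ⊤ := hΔm.measure_lt_top.ne
  have hf2 : volume (K \ Δ) ≠ ⊤ := ((measure_mono Set.sdiff_subset).trans_lt hK.measure_lt_top).ne
  refine ⟨?_, fun heq => ⟨p, q, ?_⟩⟩
  · refine hle.trans ?_
    rw [hKeq, mul_add]
    gcongr
    norm_num
  · have hz : volume (K \ Δ) = 0 := by
      rw [heq, hKeq, mul_add] at hle
      have := (ENNReal.add_le_add_iff_left (by finiteness)).1 hle
      have h3 := ENNReal.toReal_mono (by finiteness) this
      simp only [ENNReal.toReal_mul, ENNReal.toReal_ofNat] at h3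
      have h4 : (volume (K \ Δ)).toReal = 0 := by
        have : 0 ≤ (volume (K \ Δ)).toReal := ENNReal.toReal_nonneg
        linarith
      exact ((ENNReal.toReal_eq_zero_iff _).1 h4).resolve_right hf2
    have hopen : IsOpen (interior K \ Δ) := isOpen_interior.sdiff hΔm.isClosed
    have hz2 : volume (interior K \ Δ) = 0 :=
      measure_mono_null (Set.sdiff_subset_sdiff_left interior_subset) hz
    rw [hopen.measure_eq_zero_iff volume] at hz2
    apply Set.Subset.antisymm _ hΔK
    rw [← hcl]
    exact closure_minimal (Set.sdiff_eq_empty.1 hz2) hΔm.isClosed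

lemma rb_tr_hull (K : Set (ℝ × ℝ)) (hc : Convex ℝ K) (hne : K.Nonempty) (w x : ℝ × ℝ) :
    x ∈ convexHull ℝ ((fun k => k - w) '' K ∪ -((fun k => k - w) '' K)) ↔
      ∃ k1 ∈ K, ∃ k2 ∈ K, ∃ m ∈ Set.Icc (0:ℝ) 1, (1 - m) • k1 - m • k2 - (1 - 2 * m) • w = x := by
  have hc' : Convex ℝ ((fun k => k - w) '' K) := rb_conv_tr K hc w
  rw [rb_mem _ hc' (hne.image _)]
  constructor
  · rintro ⟨_, ⟨a, ha, rfl⟩, _, ⟨b, hb, rfl⟩, m, hm, rfl⟩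
    refine ⟨a, ha, b, hb, m, hm, ?_⟩
    module
  · rintro ⟨a, ha, b, hb, m, hm, rfl⟩
    refine ⟨_, ⟨a, ha, rfl⟩, _, ⟨b, hb, rfl⟩, m, hm, ?_⟩
    module

lemma rb_fubini (K : Set (ℝ × ℝ)) (hK : IsCompact K) (hc : Convex ℝ K) (hne : K.Nonempty)
    (α β : ℝ) (hα : 0 < α) (hβ : 0 < β) (f : ℝ → ENNReal)
    (hf : ∀ t, f t = volume (convexHull ℝ
      ((fun k => k - ((t, 0) : ℝ × ℝ)) '' K ∪ -((fun k => k - ((t, 0) : ℝ × ℝ)) '' K)))) :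
    ENNReal.ofReal (α + β) * f 0 ≤ ENNReal.ofReal α * f β + ENNReal.ofReal β * f (-α) := by
  let G : ℝ → Set (ℝ × ℝ) := fun t => convexHull ℝ
      ((fun k => k - ((t, 0) : ℝ × ℝ)) '' K ∪ -((fun k => k - ((t, 0) : ℝ × ℝ)) '' K))
  have hG : ∀ t x, x ∈ G t ↔ ∃ k1 ∈ K, ∃ k2 ∈ K, ∃ m ∈ Set.Icc (0:ℝ) 1,
      (1 - m) • k1 - m • k2 - (1 - 2 * m) • ((t, 0) : ℝ × ℝ) = x :=
    fun t x => rb_tr_hull K hc hne (t, 0) x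
  have hGc : ∀ t, IsCompact (G t) := fun t => by
    apply rb_compact
    · exact hK.image (by fun_prop)
    · exact rb_conv_tr K hc _
    · exact hne.image _
  have hGm : ∀ t, MeasurableSet (G t) := fun t => (hGc t).measurableSet
  have hf' : ∀ t, f t = ∫⁻ y, volume ((fun x : ℝ => (x, y)) ⁻¹' G t) := fun t => by
    rw [hf, Measure.volume_eq_prod, Measure.prod_apply_symm (hGm t)]
  have hmeas : ∀ t, Measurable fun y : ℝ => volume ((fun x : ℝ => (x, y)) ⁻¹' G t) :=
    fun t => measurable_measure_prodMk_right (hGm t)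
  rw [hf', hf', hf', ← lintegral_const_mul _ (hmeas _), ← lintegral_const_mul _ (hmeas _),
    ← lintegral_const_mul _ (hmeas _), ← lintegral_add_left ((hmeas _).const_mul _)]
  apply lintegral_mono
  intro y
  simp only
  set S : ℝ → Set ℝ := fun t => (fun x : ℝ => (x, y)) ⁻¹' G t with hS
  change ENNReal.ofReal (α + β) * volume (S 0) ≤
    ENNReal.ofReal α * volume (S β) + ENNReal.ofReal β * volume (S (-α))
  rcases (S 0).eq_empty_or_nonempty with he | hne0
  · rw [he]; simp
  have hS0 : IsCompact (S 0) := by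
    have : S 0 = Prod.fst '' (G 0 ∩ {z | z.2 = y}) := by
      ext x
      constructor
      · intro h; exact ⟨(x, y), ⟨h, rfl⟩, rfl⟩
      · rintro ⟨⟨a, b⟩, ⟨h, hb⟩, rfl⟩
        have hb' : b = y := hb
        subst hb'; exact h
    rw [this]
    exact ((hGc 0).inter_right (isClosed_eq continuous_snd continuous_const)).image continuous_fst
  have hIcc : ∀ t a b, a ∈ S t → b ∈ S t → ENNReal.ofReal (b - a) ≤ volume (S t) := by
    intro t a b ha hb
    rcases le_total b a with h | h
    · rw [ENNReal.ofReal_of_nonpos (by linarith)]; exact zero_le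
    rw [← Real.volume_Icc]
    apply measure_mono
    have hconv : Convex ℝ (S t) := by
      intro x hx z hz s r hs hr hsr
      have := convex_convexHull ℝ _ hx hz hs hr hsr
      show (s • x + r • z, y) ∈ G t
      convert this using 1
      ext
      · simp
      · simp; rw [← add_mul, hsr, one_mul]
    exact hconv.ordConnected.out ha hb
  have hl := hS0.sInf_mem hne0
  have hu := hS0.sSup_mem hne0
  have hvol : volume (S 0) ≤ ENNReal.ofReal (sSup (S 0) - sInf (S 0)) := by
    rw [← Real.volume_Icc]
    exact measure_mono fun x hx => ⟨csInf_le hS0.bddBelow hx, le_csSup hS0.bddAbove hx⟩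
  set u := sSup (S 0)
  set l := sInf (S 0)
  have shift : ∀ x ∈ S 0, ∃ m : ℝ, ∀ t, x - (1 - 2 * m) * t ∈ S t := by
    intro x hx
    obtain ⟨k1, h1, k2, h2, m, hm, h⟩ := (hG 0 _).1 hx
    refine ⟨m, fun t => (hG t _).2 ⟨k1, h1, k2, h2, m, hm, ?_⟩⟩
    have e1 := congrArg Prod.fst h
    have e2 := congrArg Prod.snd h
    simp at e1 e2
    ext
    · simp; linarith
    · simp; linarith
  obtain ⟨m1, hm1⟩ := shift u hu
  obtain ⟨m2, hm2⟩ := shift l hl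
  have i1 := hIcc β _ _ (hm2 β) (hm1 β)
  have i2 := hIcc (-α) _ _ (hm2 (-α)) (hm1 (-α))
  calc ENNReal.ofReal (α + β) * volume (S 0) ≤ ENNReal.ofReal (α + β) * ENNReal.ofReal (u - l) := by gcongr
    _ = ENNReal.ofReal (α * (u - (1 - 2 * m1) * β - (l - (1 - 2 * m2) * β)) +
          β * (u - (1 - 2 * m1) * (-α) - (l - (1 - 2 * m2) * (-α)))) := by
        rw [← ENNReal.ofReal_mul (by positivity)]; congr 1; ring
    _ ≤ _ := ENNReal.ofReal_add_le
    _ ≤ _ := by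
        rw [ENNReal.ofReal_mul hα.le, ENNReal.ofReal_mul hβ.le]
        gcongr

lemma rb_exit (K : Set (ℝ × ℝ)) (hK : IsCompact K) (h0 : (0 : ℝ × ℝ) ∈ interior K) (s : ℝ) (hs : s ≠ 0) :
    ∃ t : ℝ, 0 < t ∧ ((s * t, 0) : ℝ × ℝ) ∈ K ∧ ((s * t, 0) : ℝ × ℝ) ∉ interior K := by
  let g : ℝ → ℝ × ℝ := fun t => (s * t, 0)
  have hg : Continuous g := by fun_prop
  have hA : IsCompact (g ⁻¹' K) := by
    have hA1 : IsCompact ((fun z : ℝ × ℝ => z.1 / s) '' K) :=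
      hK.image (by fun_prop)
    apply hA1.of_isClosed_subset (hK.isClosed.preimage hg)
    intro t ht
    exact ⟨g t, ht, by simp [g]; field_simp⟩
  have h0' : (0:ℝ) ∈ g ⁻¹' K := by
    have : g 0 = 0 := by simp [g]
    rw [Set.mem_preimage, this]; exact interior_subset h0
  have hmem := hA.sSup_mem ⟨0, h0'⟩
  have key : ∀ t, g t ∈ interior K → ∃ r, t < r ∧ g r ∈ K := by
    intro t ht
    have hev : ∀ᶠ r in nhds t, g r ∈ K :=
      hg.continuousAt.eventually (mem_interior_iff_mem_nhds.1 ht)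
    obtain ⟨ε, hε, hb⟩ := Metric.eventually_nhds_iff.1 hev
    exact ⟨t + ε/2, by linarith, hb (by rw [Real.dist_eq, add_sub_cancel_left, abs_of_pos (by positivity)]; linarith)⟩
  refine ⟨sSup (g ⁻¹' K), ?_, hmem, ?_⟩
  · obtain ⟨r, hr, hrK⟩ := key 0 (by rw [show g 0 = 0 by simp [g]]; exact h0)
    exact hr.trans_le (le_csSup hA.bddAbove hrK)
  · intro h
    obtain ⟨r, hr, hrK⟩ := key _ h
    exact absurd (le_csSup hA.bddAbove hrK) (not_le.2 hr)

lemma rb_pair_interior (a b : ℝ × ℝ) : interior (convexHull ℝ {a, b}) = ∅ := by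
  by_contra h
  obtain ⟨x0, hx0⟩ := Set.nonempty_iff_ne_empty.2 h
  let φ : ℝ × ℝ →L[ℝ] ℝ := (b.2 - a.2) • ContinuousLinearMap.fst ℝ ℝ ℝ -
    (b.1 - a.1) • ContinuousLinearMap.snd ℝ ℝ ℝ
  have hφ : ∀ z, φ z = (b.2 - a.2) * z.1 - (b.1 - a.1) * z.2 := fun z => rfl
  have hconst : ∀ x ∈ convexHull ℝ {a, b}, φ x = φ a := by
    intro x hx
    rw [convexHull_pair] at hx
    obtain ⟨s, t, hs, ht, hst, rfl⟩ := hx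
    have : s = 1 - t := by linarith
    subst this
    simp only [hφ, Prod.fst_add, Prod.snd_add, Prod.smul_fst, Prod.smul_snd, smul_eq_mul]; ring
  have h1 : φ = 0 := rb_zero_of_interior _ x0 hx0 φ fun x hx => by
    rw [hconst x hx, hconst x0 (interior_subset hx0)]
  have e1 := congrArg (fun g : ℝ × ℝ →L[ℝ] ℝ => g (1,0)) h1
  have e2 := congrArg (fun g : ℝ × ℝ →L[ℝ] ℝ => g (0,1)) h1
  simp [hφ] at e1 e2
  have hab : a = b := by ext <;> linarith
  subst hab
  simp at hx0

lemma rb_extreme (K : Set (ℝ × ℝ)) (hint : (interior K).Nonempty) (w a b : ℝ × ℝ)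
    (h : K = convexHull ℝ {w, a, b}) : w ∈ K.extremePoints ℝ := by
  have hK : IsCompact K := by rw [h]; exact Set.Finite.isCompact_convexHull ℝ (by simp)
  have hc : Convex ℝ K := by rw [h]; exact convex_convexHull ℝ _
  by_contra hw
  have hsub : K.extremePoints ℝ ⊆ {a, b} := by
    intro x hx
    have hx' := hx
    rw [h] at hx'
    rcases extremePoints_convexHull_subset hx' with rfl | h'
    · exact absurd hx hw
    · exact h'
  have : K ⊆ convexHull ℝ {a, b} := by
    rw [← closure_convexHull_extremePoints hK hc]
    exact closure_minimal (convexHull_mono hsub)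
      (Set.Finite.isCompact_convexHull ℝ (by simp)).isClosed
  have := interior_mono this
  rw [rb_pair_interior] at this
  obtain ⟨x, hx⟩ := hint
  exact this hx

lemma rb_translate (K : Set (ℝ × ℝ)) (hK : IsCompact K) (hc : Convex ℝ K) (hint : (interior K).Nonempty)
    (w : ℝ × ℝ) (h0 : w ∈ K) (h0' : w ∉ interior K) :
    volume (convexHull ℝ ((fun k => k - w) '' K ∪ -((fun k => k - w) '' K))) ≤ 4 * volume K ∧
    (volume (convexHull ℝ ((fun k => k - w) '' K ∪ -((fun k => k - w) '' K))) = 4 * volume K →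
      ∃ a b : ℝ × ℝ, K = convexHull ℝ {w, a, b}) := by
  have hi : interior ((fun k => k - w) '' K) = (fun k => k - w) '' interior K :=
    ((Homeomorph.subRight w).image_interior K).symm
  have hv : volume ((fun k => k - w) '' K) = volume K := by
    simp [sub_eq_add_neg]
  have := rb_boundary ((fun k => k - w) '' K) (hK.image (by fun_prop))
    (rb_conv_tr K hc w) (by rw [hi]; exact hint.image _)
    ⟨w, h0, by simp⟩ (by
      rw [hi]; rintro ⟨x, hx, hxw⟩
      have : x = w := sub_eq_zero.1 hxw
      subst this; exact h0' hx)
  rw [hv] at this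
  refine ⟨this.1, fun h => ?_⟩
  obtain ⟨a, b, hab⟩ := this.2 h
  refine ⟨a + w, b + w, ?_⟩
  have h1 : K = (AffineEquiv.constVAdd ℝ (ℝ × ℝ) w).toAffineMap '' ((fun k => k - w) '' K) := by
    rw [Set.image_image]; simp
  rw [h1, hab, AffineMap.image_convexHull]
  simp [Set.image_insert_eq, add_comm]

lemma rb_main (K : Set (ℝ × ℝ)) (hK : IsCompact K) (hc : Convex ℝ K) (hint : (interior K).Nonempty)
    (h0 : (0 : ℝ × ℝ) ∈ K) :
    volume (convexHull ℝ (K ∪ -K)) = 4 * volume K ↔ ∃ a b : ℝ × ℝ, K = convexHull ℝ {0, a, b} := by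
  constructor
  · intro heq
    by_cases hin : (0 : ℝ × ℝ) ∈ interior K
    swap
    · exact (rb_boundary K hK hc hint h0 hin).2 heq
    exfalso
    obtain ⟨β, hβ, hw, hw'⟩ := rb_exit K hK hin 1 (by norm_num)
    obtain ⟨α, hα, hv, hv'⟩ := rb_exit K hK hin (-1) (by norm_num)
    rw [one_mul] at hw hw'
    rw [neg_one_mul] at hv hv'
    obtain ⟨W1, W2⟩ := rb_translate K hK hc hint _ hw hw'
    obtain ⟨V1, V2⟩ := rb_translate K hK hc hint _ hv hv'
    have hF := rb_fubini K hK hc ⟨0, h0⟩ α β hα hβ _ (fun t => rfl)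
    have hz : (fun k : ℝ × ℝ => k - ((0:ℝ), (0:ℝ))) '' K = K := by
      have : (fun k : ℝ × ℝ => k - ((0:ℝ), (0:ℝ))) = id := by ext x <;> simp
      rw [this, Set.image_id]
    simp only [hz] at hF
    rw [heq] at hF
    have hfin : 4 * volume K ≠ ⊤ := ENNReal.mul_ne_top (by simp) hK.measure_lt_top.ne
    generalize volume (convexHull ℝ ((fun k => k - ((β, 0) : ℝ × ℝ)) '' K ∪
      -((fun k => k - ((β, 0) : ℝ × ℝ)) '' K))) = X at *
    generalize volume (convexHull ℝ ((fun k => k - ((-α, 0) : ℝ × ℝ)) '' K ∪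
      -((fun k => k - ((-α, 0) : ℝ × ℝ)) '' K))) = Y at *
    generalize 4 * volume K = Z at *
    have hX : X ≠ ⊤ := ne_top_of_le_ne_top hfin W1
    have hY : Y ≠ ⊤ := ne_top_of_le_ne_top hfin V1
    lift X to NNReal using hX
    lift Y to NNReal using hY
    lift Z to NNReal using hfin
    have hF' := ENNReal.toReal_mono (by finiteness) hF
    rw [ENNReal.toReal_add (by finiteness) (by finiteness)] at hF'
    simp only [ENNReal.toReal_mul, ENNReal.toReal_ofReal hα.le, ENNReal.toReal_ofReal hβ.le,
      ENNReal.toReal_ofReal (add_pos hα hβ).le, ENNReal.coe_toReal] at hF'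
    have hW1 : (X:ℝ) ≤ Z := by exact_mod_cast W1
    have hV1 : (Y:ℝ) ≤ Z := by exact_mod_cast V1
    have hXZ : (X:ℝ) = Z := by nlinarith
    have hYZ : (Y:ℝ) = Z := by nlinarith
    obtain ⟨a, b, hab⟩ := W2 (by rw [NNReal.coe_injective hXZ])
    obtain ⟨c, d, hcd⟩ := V2 (by rw [NNReal.coe_injective hYZ])
    have hex := rb_extreme K hint _ c d hcd
    have hex' := hex
    rw [hab] at hex'
    -- one of a, b has zero second coordinate
    have fin : ∀ a b : ℝ × ℝ, K = convexHull ℝ {((β:ℝ), (0:ℝ)), a, b} → ((-α:ℝ), (0:ℝ)) = a → False := by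
      intro a b hab ha
      let ψ := ContinuousLinearMap.snd ℝ ℝ ℝ
      have hcase : ∀ φ : ℝ × ℝ →L[ℝ] ℝ, φ (1, 0) = 0 → φ b ≤ 0 → φ = 0 := by
        intro φ h1 h2
        apply rb_zero_of_interior K 0 hin
        intro x hx
        rw [map_zero]
        have hs : K ⊆ {x | φ x ≤ 0} := by
          rw [hab]
          apply convexHull_min _ (convex_halfSpace_le φ.toLinearMap.isLinear 0)
          rintro z (rfl | rfl | rfl)
          · show φ _ ≤ 0
            rw [rb_clm, h1]; simp
          · show φ _ ≤ 0
            rw [← ha, rb_clm, h1]; simp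
          · exact h2
        exact hs hx
      rcases le_total b.2 0 with hb | hb
      · have := hcase ψ (by simp [ψ]) (by simpa [ψ] using hb)
        have := congrArg (fun g : ℝ × ℝ →L[ℝ] ℝ => g (0,1)) this
        simp [ψ] at this
      · have := hcase (-ψ) (by simp [ψ]) (by simpa [ψ] using hb)
        have := congrArg (fun g : ℝ × ℝ →L[ℝ] ℝ => g (0,1)) this
        simp [ψ] at this
    rcases extremePoints_convexHull_subset hex' with h | h | h
    · have := congrArg Prod.fst h
      simp at this; linarith
    · exact fin a b hab h
    · exact fin b a (by rw [hab, Set.pair_comm]) h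
  · rintro ⟨a, b, hab⟩
    have : convexHull ℝ (K ∪ -K) = convexHull ℝ {a, b, -a, -b} := by
      apply Set.Subset.antisymm
      · have h0P : (0 : ℝ × ℝ) ∈ convexHull ℝ {a, b, -a, -b} := by
          have := (convex_convexHull ℝ {a, b, -a, -b}) (subset_convexHull ℝ _ (show a ∈ _ by simp))
            (subset_convexHull ℝ _ (show -a ∈ _ by simp)) (show (0:ℝ) ≤ 1/2 by norm_num)
            (show (0:ℝ) ≤ 1/2 by norm_num) (by norm_num)
          simpa using this
        apply convexHull_min _ (convex_convexHull ℝ _)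
        apply Set.union_subset
        · rw [hab]
          apply convexHull_min _ (convex_convexHull ℝ _)
          rintro x (rfl | rfl | rfl)
          · exact h0P
          · exact subset_convexHull ℝ _ (by simp)
          · exact subset_convexHull ℝ _ (by simp)
        · rw [hab, ← convexHull_neg]
          apply convexHull_min _ (convex_convexHull ℝ _)
          intro x hx
          rcases hx with h | h | h
          · rw [neg_eq_zero.1 h]; exact h0P
          · rw [neg_eq_iff_eq_neg.1 h]; exact subset_convexHull ℝ _ (by simp)
          · rw [neg_eq_iff_eq_neg.1 h]; exact subset_convexHull ℝ _ (by simp)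
      · apply convexHull_mono
        have ha : a ∈ K := by rw [hab]; exact subset_convexHull ℝ _ (by simp)
        have hb : b ∈ K := by rw [hab]; exact subset_convexHull ℝ _ (by simp)
        rintro x (rfl | rfl | rfl | rfl)
        · exact Or.inl ha
        · exact Or.inl hb
        · exact Or.inr (by simpa using ha)
        · exact Or.inr (by simpa using hb)
    rw [this, rb_area, hab]

/-- For a compact convex body `K ⊆ ℝ²` (nonempty interior) containing the origin,
equality `|conv(K ∪ (−K))| = 4·|K|` holds if and only if `K` is a triangle with one
vertex at the origin. -/
theorem reflection_body_volume_eq_iff (K : Set (EuclideanSpace ℝ (Fin 2)))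
    (hK : IsCompact K) (hconv : Convex ℝ K) (hint : (interior K).Nonempty)
    (h0 : (0 : EuclideanSpace ℝ (Fin 2)) ∈ K) :
    volume (convexHull ℝ (K ∪ -K)) = 4 * volume K ↔
      ∃ a b : EuclideanSpace ℝ (Fin 2), K = convexHull ℝ {0, a, b} := by
  let T : EuclideanSpace ℝ (Fin 2) ≃L[ℝ] ℝ × ℝ :=
    (EuclideanSpace.equiv (Fin 2) ℝ).trans (ContinuousLinearEquiv.finTwoArrow ℝ ℝ)
  have hT : MeasurePreserving T volume volume :=
    (volume_preserving_finTwoArrow ℝ).comp (PiLp.volume_preserving_ofLp (Fin 2))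
  have hvol : ∀ S, volume (T '' S) = volume S := by
    intro S
    rw [← hT.measure_preimage_emb T.toHomeomorph.measurableEmbedding,
      Set.preimage_image_eq _ T.injective]
  have hhull : ∀ S, T '' (convexHull ℝ S) = convexHull ℝ (T '' S) := fun S =>
    LinearMap.image_convexHull (T : EuclideanSpace ℝ (Fin 2) →ₗ[ℝ] ℝ × ℝ) S
  have hneg : T '' (-K) = -(T '' K) := Set.image_neg_of_apply_neg_eq_neg fun x _ => map_neg T x
  have hm := rb_main (T '' K) (hK.image T.continuous)
    (hconv.linear_image (T : EuclideanSpace ℝ (Fin 2) →ₗ[ℝ] ℝ × ℝ))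
    (by
      have := T.toHomeomorph.image_interior K
      have h2 : interior (T '' K) = T '' interior K := this.symm
      rw [h2]; exact hint.image _)
    ⟨0, h0, map_zero T⟩
  rw [← hneg, ← Set.image_union, ← hhull, hvol, hvol] at hm
  rw [hm]
  constructor
  · rintro ⟨a, b, hab⟩
    refine ⟨T.symm a, T.symm b, ?_⟩
    apply T.injective.image_injective
    rw [hhull, hab]
    simp [Set.image_insert_eq]
  · rintro ⟨a, b, hab⟩
    refine ⟨T a, T b, ?_⟩
    rw [hab, hhull]
    simp [Set.image_insert_eq]
end

section
/- The function f : ℕ≥1 → ℝ defined by f(n) := 2·√n / (n!·ω_n)^{1/n} is strictly monotone increasing (f(n) < f(n+1) for all n ≥ 1), satisfies f(2) = 2/√π, and lim_{n→∞} f(n) = √(2e/π). -/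
open Filter MeasureTheory

/-- `ω_n`: the Lebesgue volume of the closed Euclidean unit ball in `ℝⁿ`. -/
noncomputable def unitBallVol (n : ℕ) : ℝ :=
  (volume (Metric.closedBall (0 : EuclideanSpace ℝ (Fin n)) 1)).toReal

namespace FSM

noncomputable def a (n : ℕ) : ℝ :=
  Real.log (Real.Gamma (((n : ℝ) + 1) / 2)) - Real.log (Real.sqrt Real.pi)

noncomputable def u (x : ℝ) : ℝ := x * Real.log x

noncomputable def h (n : ℕ) : ℝ := u n / 2 - a n

noncomputable def D (n : ℕ) : ℝ := h (n + 1) - h n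

lemma a_zero : a 0 = 0 := by
  simp only [a]
  rw [show ((0 : ℕ) + 1 : ℝ) / 2 = 1 / 2 by norm_num, Real.Gamma_one_half_eq]
  simp

lemma h_zero : h 0 = 0 := by simp [h, a_zero, u]

lemma h_sum (n : ℕ) : ∑ i ∈ Finset.range n, D i = h n := by
  have := Finset.sum_range_sub h n
  simpa [D, h_zero] using this

lemma a_rec (n : ℕ) : a (n + 2) = a n + Real.log (((n : ℝ) + 1) / 2) := by
  simp only [a]
  have hp : (0 : ℝ) < ((n : ℝ) + 1) / 2 := by positivity
  rw [show (((n + 2 : ℕ) : ℝ) + 1) / 2 = ((n : ℝ) + 1) / 2 + 1 by push_cast; ring,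
    Real.Gamma_add_one hp.ne', Real.log_mul hp.ne' (Real.Gamma_pos_of_pos hp).ne']
  ring

lemma a_convex (n : ℕ) : 2 * a (n + 1) ≤ a n + a (n + 2) := by
  have hc := Real.convexOn_log_Gamma.2
    (show ((n : ℝ) + 1) / 2 ∈ Set.Ioi (0 : ℝ) by simp only [Set.mem_Ioi]; positivity)
    (show ((n : ℝ) + 3) / 2 ∈ Set.Ioi (0 : ℝ) by simp only [Set.mem_Ioi]; positivity)
    (show (0 : ℝ) ≤ 1 / 2 by norm_num) (show (0 : ℝ) ≤ 1 / 2 by norm_num) (by norm_num)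
  simp only [Function.comp, smul_eq_mul] at hc
  simp only [a]
  rw [show (((n + 2 : ℕ) : ℝ) + 1) / 2 = ((n : ℝ) + 3) / 2 by push_cast; ring,
    show (((n + 1 : ℕ) : ℝ) + 1) / 2 = 1 / 2 * (((n : ℝ) + 1) / 2) + 1 / 2 * (((n : ℝ) + 3) / 2) by
      push_cast; ring]
  linarith

lemma d_upper (n : ℕ) : a (n + 1) - a n ≤ Real.log (((n : ℝ) + 1) / 2) / 2 := by
  have h1 := a_rec n
  have h2 := a_convex n
  linarith

lemma d_lower (n : ℕ) : Real.log (((n : ℝ) + 1) / 2) / 2 ≤ a (n + 2) - a (n + 1) := by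
  have h1 := a_rec n
  have h2 := a_convex n
  linarith

lemma u_scale (m x : ℝ) (hm : 0 < m) : u x = m * u (x / m) + x * Real.log m := by
  unfold u
  rcases eq_or_ne x 0 with rfl | hx
  · simp
  · rw [Real.log_div hx hm.ne']
    field_simp
    ring

lemma log_ratio_tendsto :
    Tendsto (fun n : ℕ => Real.log ((n + 1 : ℝ) + 1) - Real.log ((n : ℝ) + 1)) atTop (nhds 0) := by
  have h1 : Tendsto (fun n : ℕ => Real.log (1 + 1 / ((n : ℝ) + 1))) atTop (nhds 0) := by
    have h2 := (tendsto_one_div_add_atTop_nhds_zero_nat (𝕜 := ℝ)).const_add 1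
    have h3 := h2.log (by norm_num)
    simpa using h3
  refine h1.congr fun n => ?_
  have : (0 : ℝ) < (n : ℝ) + 1 := by positivity
  rw [← Real.log_div (by positivity) (by positivity)]
  congr 1
  field_simp

lemma n_log_tendsto :
    Tendsto (fun n : ℕ => ((n : ℝ) + 1) * (Real.log ((n + 1 : ℝ) + 1) - Real.log ((n : ℝ) + 1)))
      atTop (nhds 1) := by
  have h1 := (Real.tendsto_mul_log_one_add_div_atTop 1).comp
    ((tendsto_natCast_atTop_atTop (R := ℝ)).comp (tendsto_add_atTop_nat 1))
  refine h1.congr fun n => ?_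
  have : (0 : ℝ) < (n : ℝ) + 1 := by positivity
  rw [← Real.log_div (by positivity) (by positivity)]
  simp only [Function.comp]
  push_cast
  congr 2
  field_simp

lemma D_succ_eq (n : ℕ) : D (n + 1) =
    (Real.log ((n + 1 : ℝ) + 1) + ((n : ℝ) + 1) * (Real.log ((n + 1 : ℝ) + 1) - Real.log ((n : ℝ) + 1))) / 2
      - (a (n + 2) - a (n + 1)) := by
  simp only [D, h, u]
  push_cast
  ring_nf

lemma D_tendsto : Tendsto D atTop (nhds ((1 + Real.log 2) / 2)) := by
  rw [← tendsto_add_atTop_iff_nat 1]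
  have l1 : Tendsto (fun n : ℕ => (((n : ℝ) + 1) * (Real.log ((n + 1 : ℝ) + 1) - Real.log ((n : ℝ) + 1))
      + Real.log 2) / 2) atTop (nhds ((1 + Real.log 2) / 2)) :=
    (n_log_tendsto.add_const _).div_const 2
  have l2 := (log_ratio_tendsto.div_const 2).add l1
  rw [zero_div, zero_add] at l2
  refine tendsto_of_tendsto_of_tendsto_of_le_of_le l1 l2 ?_ ?_
  · intro n
    have h1 := d_upper (n + 1)
    rw [Real.log_div (by positivity) (by norm_num)] at h1
    push_cast at h1
    simp only [D_succ_eq]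
    linarith
  · intro n
    have h1 := d_lower n
    rw [Real.log_div (by positivity) (by norm_num)] at h1
    simp only [D_succ_eq]
    linarith

lemma K_pos (s : ℝ) (hs : 0 < s) (hs' : s < 1 / 4) :
    0 < 2 * Real.log (1 - s) - Real.log (1 - 4 * s) - 2 * s / (1 - s) := by
  let K : ℝ → ℝ := fun s => 2 * Real.log (1 - s) - Real.log (1 - 4 * s) - 2 * s / (1 - s)
  have hd : ∀ x ∈ Set.Ico (0 : ℝ) (1 / 4), HasDerivAt K
      (2 * (-1 / (1 - x)) - (-4) / (1 - 4 * x) - (2 * (1 - x) - 2 * x * (-1)) / (1 - x) ^ 2) x := by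
    intro x hx
    have h1 : (1 - x) ≠ 0 := by linarith [hx.2]
    have h2 : (1 - 4 * x) ≠ 0 := by linarith [hx.2]
    have e1 : HasDerivAt (fun x : ℝ => 1 - x) (-1) x := by
      simpa using (hasDerivAt_id x).const_sub 1
    have e2 : HasDerivAt (fun x : ℝ => 1 - 4 * x) (-4) x := by
      simpa using ((hasDerivAt_id x).const_mul 4).const_sub 1
    have e3 : HasDerivAt (fun x : ℝ => 2 * x) 2 x := by
      simpa using ((hasDerivAt_id x).const_mul 2)
    exact (((e1.log h1).const_mul 2).sub (e2.log h2)).sub (e3.div e1 h1)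
  have hm : StrictMonoOn K (Set.Ico 0 (1 / 4)) := by
    refine strictMonoOn_of_deriv_pos (convex_Ico _ _)
      (fun x hx => (hd x hx).continuousAt.continuousWithinAt) ?_
    intro x hx
    rw [interior_Ico] at hx
    rw [(hd x ⟨hx.1.le, hx.2⟩).deriv]
    have h0 := hx.1
    have h1 : 0 < (1 - x) := by linarith [hx.2]
    have h2 : 0 < (1 - 4 * x) := by linarith [hx.2]
    have : 2 * (-1 / (1 - x)) - (-4) / (1 - 4 * x) - (2 * (1 - x) - 2 * x * (-1)) / (1 - x) ^ 2
        = x * (10 - 4 * x) / ((1 - 4 * x) * (1 - x) ^ 2) := by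
      have n1 := h1.ne'
      have n2 := h2.ne'
      rw [eq_div_iff (by positivity)]
      have q1 : (1 - x) * (1 / (1 - x)) = 1 := by field_simp
      have q2 : (1 - 4 * x) * (1 / (1 - 4 * x)) = 1 := mul_one_div_cancel n2
      generalize hp : 1 / (1 - x) = p at q1
      generalize hq : 1 / (1 - 4 * x) = q at q2
      have r1 : -1 / (1 - x) = -p := by rw [← hp]; ring
      have r2 : -4 / (1 - 4 * x) = -4 * q := by rw [← hq]; ring
      have r3 : (2 * (1 - x) - 2 * x * (-1)) / (1 - x) ^ 2 = 2 * p ^ 2 := by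
        rw [← hp, div_pow, one_pow]; ring
      rw [r1, r2, r3]
      linear_combination (-2 * (1 - 4 * x) * (1 - x)) * q1 + 4 * (1 - x) ^ 2 * q2
        - 2 * (1 - 4 * x) * ((1 - x) * p + 1) * q1
    rw [this]
    have : 0 < 10 - 4 * x := by linarith [hx.2]
    positivity
  have := hm (a := 0) (b := s) (by norm_num) ⟨hs.le, hs'⟩ hs
  simpa [K] using this

lemma u_cont : Continuous u := Real.continuous_mul_log

lemma u_deriv (x : ℝ) (hx : x ≠ 0) : HasDerivAt u (Real.log x + 1) x :=
  Real.hasDerivAt_mul_log hx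

lemma F_pos (t : ℝ) (ht : 0 < t) (ht' : t ≤ 1 / 2) :
    0 < (u (1 - 2 * t) - u (1 + 2 * t)) / 2 + u (1 + t) - u (1 - t) + t * Real.log (1 - t ^ 2) := by
  let F : ℝ → ℝ := fun t =>
    (u (1 - 2 * t) - u (1 + 2 * t)) / 2 + u (1 + t) - u (1 - t) + t * Real.log (1 - t ^ 2)
  have hm : StrictMonoOn F (Set.Icc 0 (1 / 2)) := by
    refine strictMonoOn_of_deriv_pos (convex_Icc _ _) ?_ ?_
    · have := u_cont
      have h1 : ContinuousOn (fun t : ℝ => Real.log (1 - t ^ 2)) (Set.Icc 0 (1 / 2)) := by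
        refine ContinuousOn.log (by fun_prop) ?_
        intro x hx
        have := hx.1
        have := hx.2
        nlinarith
      fun_prop
    · intro x hx
      rw [interior_Icc] at hx
      obtain ⟨h0, h1⟩ := hx
      have p1 : 0 < 1 - 2 * x := by linarith
      have p2 : 0 < 1 + 2 * x := by linarith
      have p3 : 0 < 1 + x := by linarith
      have p4 : 0 < 1 - x := by linarith
      have p5 : 0 < 1 - x ^ 2 := by nlinarith
      have i1 : HasDerivAt (fun x : ℝ => 1 - 2 * x) (-2) x := by
        simpa using ((hasDerivAt_id x).const_mul 2).const_sub 1
      have i2 : HasDerivAt (fun x : ℝ => 1 + 2 * x) 2 x := by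
        simpa using ((hasDerivAt_id x).const_mul 2).const_add 1
      have i3 : HasDerivAt (fun x : ℝ => 1 + x) 1 x := by
        simpa using (hasDerivAt_id x).const_add 1
      have i4 : HasDerivAt (fun x : ℝ => 1 - x) (-1) x := by
        simpa using (hasDerivAt_id x).const_sub 1
      have i5 : HasDerivAt (fun x : ℝ => 1 - x ^ 2) (-(2 * x)) x := by
        simpa using (hasDerivAt_pow 2 x).const_sub 1
      have e1 := (u_deriv _ p1.ne').comp x i1
      have e2 := (u_deriv _ p2.ne').comp x i2
      have e3 := (u_deriv _ p3.ne').comp x i3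
      have e4 := (u_deriv _ p4.ne').comp x i4
      have e5 := (hasDerivAt_id x).mul (i5.log p5.ne')
      have e : HasDerivAt F _ x := ((((e1.sub e2).div_const 2).add e3).sub e4).add e5
      rw [e.deriv]
      have hK := K_pos (x ^ 2) (by positivity) (by nlinarith)
      have l1 : Real.log (1 - 4 * x ^ 2) = Real.log (1 - 2 * x) + Real.log (1 + 2 * x) := by
        rw [← Real.log_mul p1.ne' p2.ne']; ring_nf
      have l2 : Real.log (1 - x ^ 2) = Real.log (1 - x) + Real.log (1 + x) := by
        rw [← Real.log_mul p4.ne' p3.ne']; ring_nf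
      simp only [id]
      have l3 : x * (-(2 * x) / (1 - x ^ 2)) = - (2 * x ^ 2 / (1 - x ^ 2)) := by ring
      rw [l3]
      linarith
  have := hm (a := 0) (b := t) (by norm_num) ⟨ht.le, ht'⟩ ht
  simpa [F] using this

lemma G_pos (m : ℝ) (hm : 2 ≤ m) :
    0 < (u (m - 2) - u (m + 2)) / 2 + u (m + 1) - u (m - 1)
      + (Real.log (m - 1) + Real.log (m + 1) - 2 * Real.log m) := by
  have h0 : 0 < m := by linarith
  have hF := F_pos (1 / m) (by positivity) (by
    rw [div_le_div_iff₀ h0 (by norm_num)]; linarith)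
  have hl : Real.log (1 - (1 / m) ^ 2) = Real.log (m - 1) + Real.log (m + 1) - 2 * Real.log m := by
    have : 1 - (1 / m) ^ 2 = (m - 1) * (m + 1) / m ^ 2 := by field_simp; ring
    have h1 : m - 1 ≠ 0 := by linarith
    rw [this, Real.log_div (mul_ne_zero h1 (by positivity)) (by positivity),
      Real.log_mul h1 (by positivity), Real.log_pow]
    push_cast; ring
  rw [hl] at hF
  rw [u_scale m (m - 2) h0, u_scale m (m + 2) h0, u_scale m (m - 1) h0, u_scale m (m + 1) h0]
  rw [show (m - 2) / m = 1 - 2 * (1 / m) by field_simp,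
    show (m + 2) / m = 1 + 2 * (1 / m) by field_simp,
    show (m - 1) / m = 1 - (1 / m) by field_simp,
    show (m + 1) / m = 1 + (1 / m) by field_simp]
  have := mul_pos h0 hF
  have e : m * (1 / m * (Real.log (m - 1) + Real.log (m + 1) - 2 * Real.log m)) =
    (Real.log (m - 1) + Real.log (m + 1) - 2 * Real.log m) := by field_simp
  linarith

lemma E_dec (n : ℕ) : D (n + 3) - D (n + 2) < D (n + 1) - D n := by
  have hG := G_pos ((n : ℝ) + 2) (by linarith [(Nat.cast_nonneg n : (0 : ℝ) ≤ n)])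
  have r0 := a_rec n
  have r1 := a_rec (n + 1)
  have r2 := a_rec (n + 2)
  rw [Real.log_div (by positivity) (by norm_num)] at r0 r1 r2
  simp only [D, h]
  push_cast at *
  ring_nf at *
  linarith

lemma E_pos (n : ℕ) : D n < D (n + 1) := by
  have key : ∀ n : ℕ, 0 ≤ D (n + 1) - D n := by
    intro n
    have ha : Antitone (fun k : ℕ => D (n + 2 * k + 1) - D (n + 2 * k)) :=
      antitone_nat_of_succ_le fun k => (E_dec (n + 2 * k)).le
    have ht : Tendsto (fun k : ℕ => n + 2 * k) atTop atTop :=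
      tendsto_atTop_mono (fun k => by simp only [id]; omega) tendsto_id
    have l := ((D_tendsto.comp (tendsto_add_atTop_nat 1)).sub D_tendsto).comp ht
    rw [sub_self] at l
    exact ha.le_of_tendsto l 0
  have := key (n + 2)
  have := E_dec n
  linarith

lemma h_mono (n : ℕ) (hn : 1 ≤ n) : h n / n < h (n + 1) / (n + 1 : ℝ) := by
  have hs : StrictMono D := strictMono_nat_of_lt_succ E_pos
  have h1 : h n < n * D n := by
    rw [← h_sum]
    calc _ < ∑ i ∈ Finset.range n, D n :=
          Finset.sum_lt_sum_of_nonempty (by simp; omega) fun i hi => hs (Finset.mem_range.1 hi)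
      _ = _ := by simp
  have h2 : h (n + 1) = h n + D n := by simp [D]
  have hn' : (0 : ℝ) < n := by exact_mod_cast hn
  rw [h2, div_lt_div_iff₀ hn' (by positivity)]
  linarith

lemma h_tendsto : Tendsto (fun n : ℕ => h n / n) atTop (nhds ((1 + Real.log 2) / 2)) := by
  refine D_tendsto.cesaro.congr fun n => ?_
  rw [h_sum]
  ring

lemma vol_eq (n : ℕ) (hn : 1 ≤ n) :
    unitBallVol n = Real.sqrt Real.pi ^ n / Real.Gamma ((n : ℝ) / 2 + 1) := by
  have : Nonempty (Fin n) := ⟨⟨0, hn⟩⟩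
  unfold unitBallVol
  rw [EuclideanSpace.volume_closedBall]
  simp only [ENNReal.ofReal_one, one_pow, one_mul, Fintype.card_fin]
  exact ENNReal.toReal_ofReal (by positivity)

lemma fv_eq (n : ℕ) (hn : 1 ≤ n) :
    (n.factorial : ℝ) * unitBallVol n =
      Real.exp (n * Real.log 2 + n * (Real.log Real.pi / 2) + a n) := by
  rw [vol_eq n hn]
  have hd := Real.Gamma_mul_Gamma_add_half (((n : ℝ) + 1) / 2)
  rw [show 2 * (((n : ℝ) + 1) / 2) = n + 1 by ring, Real.Gamma_nat_eq_factorial,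
    show ((n : ℝ) + 1) / 2 + 1 / 2 = n / 2 + 1 by ring, show 1 - ((n : ℝ) + 1) = -n by ring,
    Real.rpow_neg (by norm_num), Real.rpow_natCast] at hd
  have g1 : 0 < Real.Gamma ((n : ℝ) / 2 + 1) := Real.Gamma_pos_of_pos (by positivity)
  have g2 : 0 < Real.Gamma (((n : ℝ) + 1) / 2) := Real.Gamma_pos_of_pos (by positivity)
  have sp : 0 < Real.sqrt Real.pi := Real.sqrt_pos.2 Real.pi_pos
  rw [Real.exp_add, Real.exp_add, Real.exp_nat_mul, Real.exp_nat_mul, Real.exp_log (by norm_num),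
    ← Real.log_sqrt Real.pi_pos.le, Real.exp_log sp, a, Real.exp_sub, Real.exp_log g2,
    Real.exp_log sp]
  field_simp
  field_simp at hd
  linear_combination (-1) * hd

lemma f_eq (n : ℕ) (hn : 1 ≤ n) :
    2 * Real.sqrt n / ((n.factorial : ℝ) * unitBallVol n) ^ ((1 : ℝ) / n) =
      Real.exp (h n / n - Real.log Real.pi / 2) := by
  have hn' : (0 : ℝ) < n := by exact_mod_cast hn
  rw [fv_eq n hn, ← Real.exp_mul]
  have e1 : Real.sqrt n = Real.exp (Real.log n / 2) := by
    rw [← Real.log_sqrt hn'.le, Real.exp_log (Real.sqrt_pos.2 hn')]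
  rw [e1]
  nth_rewrite 1 [← Real.exp_log (show (0 : ℝ) < 2 by norm_num)]
  rw [← Real.exp_add, ← Real.exp_sub]
  congr 1
  simp only [h, u]
  field_simp
  ring

end FSM

/-- The function `f(n) = 2·√n / (n!·ω_n)^{1/n}` is strictly monotone increasing on
`n ≥ 1`, satisfies `f(2) = 2/√π`, and tends to `√(2e/π)`. -/
theorem f_strictMono_value_limit :
    (∀ n : ℕ, 1 ≤ n →
        2 * Real.sqrt n / ((n.factorial : ℝ) * unitBallVol n) ^ ((1 : ℝ) / n) <
          2 * Real.sqrt (n + 1) /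
            (((n + 1).factorial : ℝ) * unitBallVol (n + 1)) ^ ((1 : ℝ) / (n + 1))) ∧
    2 * Real.sqrt 2 / (((2 : ℕ).factorial : ℝ) * unitBallVol 2) ^ ((1 : ℝ) / 2) =
      2 / Real.sqrt Real.pi ∧
    Tendsto
      (fun n : ℕ => 2 * Real.sqrt n / ((n.factorial : ℝ) * unitBallVol n) ^ ((1 : ℝ) / n))
      atTop (nhds (Real.sqrt (2 * Real.exp 1 / Real.pi))) := by
  refine ⟨?_, ?_, ?_⟩
  · intro n hn
    have h1 := FSM.f_eq (n + 1) (by omega)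
    push_cast at h1 ⊢
    rw [FSM.f_eq n hn]
    rw [Nat.factorial_succ] at *
    push_cast at h1 ⊢
    rw [h1]
    apply Real.exp_lt_exp.2
    linarith [FSM.h_mono n hn]
  · rw [FSM.vol_eq 2 (by norm_num), Real.sq_sqrt Real.pi_pos.le]
    norm_num
    rw [← Real.sqrt_eq_rpow, Real.sqrt_mul (by norm_num)]
    have : 0 < Real.sqrt Real.pi := Real.sqrt_pos.2 Real.pi_pos
    field_simp
  · have l := (FSM.h_tendsto.sub_const (Real.log Real.pi / 2)).rexp
    have e : Real.exp ((1 + Real.log 2) / 2 - Real.log Real.pi / 2) =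
        Real.sqrt (2 * Real.exp 1 / Real.pi) := by
      have hp := Real.pi_pos
      rw [← Real.exp_log (show 0 < Real.sqrt (2 * Real.exp 1 / Real.pi) by positivity),
        Real.log_sqrt (by positivity), Real.log_div (by positivity) hp.ne',
        Real.log_mul (by norm_num) (by positivity), Real.log_exp]
      congr 1
      ring
    rw [e] at l
    refine l.congr' ?_
    filter_upwards [eventually_ge_atTop 1] with n hn
    exact (FSM.f_eq n hn).symm
end

section
/- The sequence (a_k)_{k≥1} defined by a_k := (k!)^{1/(2k)} / √k is monotone decreasing (a_{k+1} ≤ a_k for all k ≥ 1) and converges to 1/√e, i.e. lim_{k→∞} (k!)^{1/(2k)} / √k = e^{−1/2}. -/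
open Filter

lemma aux_step (k : ℕ) (hk : 1 ≤ k) :
    0 ≤ ((k:ℝ)+1) * Real.log (k+2) - (2*k+1) * Real.log (k+1) + k * Real.log k := by
  have hk0 : (0:ℝ) < k := by exact_mod_cast hk
  have hc := strictConcaveOn_log_Ioi.concaveOn.2
  have h := hc (x := ((k:ℝ)+1)/k) (Set.mem_Ioi.2 (by positivity)) (y := 1) (Set.mem_Ioi.2 one_pos)
    (by positivity : 0 ≤ (k:ℝ)/(k+1)) (by positivity : 0 ≤ 1/((k:ℝ)+1)) (by field_simp)
  simp only [smul_eq_mul, Real.log_one, mul_zero, add_zero, mul_one] at h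
  have e : (k:ℝ)/(k+1) * ((k+1)/k) + 1/((k:ℝ)+1) = (k+2)/(k+1) := by field_simp; ring
  rw [e, Real.log_div (by positivity) (by positivity), Real.log_div (by positivity) (by positivity),
    div_mul_eq_mul_div, div_le_iff₀ (by positivity)] at h
  linarith

lemma aux_D (k : ℕ) (hk : 1 ≤ k) :
    0 ≤ Real.log (k.factorial : ℝ) + (k:ℝ)^2 * Real.log (k+1) - k * (k+1) * Real.log k := by
  induction k, hk using Nat.le_induction with
  | base => 
    have := Real.log_nonneg (x := 1 + 1) (by norm_num)
    simpa using this
  | succ k hk ih =>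
    have h := mul_nonneg (by positivity : (0:ℝ) ≤ k + 1) (aux_step k hk)
    have hf : Real.log ((k+1).factorial : ℝ) = Real.log (k+1) + Real.log (k.factorial : ℝ) := by
      rw [Nat.factorial_succ, Nat.cast_mul, Real.log_mul (by positivity) (by positivity)]
      push_cast; rfl
    rw [hf]
    push_cast
    have e : (k:ℝ)+1+1 = k+2 := by ring
    rw [e]
    nlinarith

lemma aux_eq (k : ℕ) (hk : 1 ≤ k) :
    ((k.factorial : ℝ)) ^ ((1 : ℝ) / (2 * k)) / Real.sqrt k =
      Real.exp ((Real.log (k.factorial : ℝ) / k - Real.log k) / 2) := by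
  have hk0 : (0:ℝ) < k := by exact_mod_cast hk
  rw [Real.rpow_def_of_pos (by positivity), Real.sqrt_eq_rpow, Real.rpow_def_of_pos hk0,
    ← Real.exp_sub]
  congr 1
  field_simp

/-- The sequence `a_k = (k!)^{1/(2k)} / √k` is monotone decreasing for `k ≥ 1` and
converges to `1/√e`. -/
theorem factorial_root_div_sqrt_antitone_limit :
    (∀ k : ℕ, 1 ≤ k →
        ((((k + 1).factorial : ℝ)) ^ ((1 : ℝ) / (2 * (k + 1))) / Real.sqrt (k + 1)) ≤
          (((k.factorial : ℝ)) ^ ((1 : ℝ) / (2 * k)) / Real.sqrt k)) ∧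
    Tendsto (fun k : ℕ => ((k.factorial : ℝ)) ^ ((1 : ℝ) / (2 * k)) / Real.sqrt k)
      atTop (nhds (1 / Real.sqrt (Real.exp 1))) := by
  constructor
  · intro k hk
    have hk0 : (0:ℝ) < k := by exact_mod_cast hk
    have h1 := aux_eq (k+1) (by omega)
    push_cast at h1
    rw [h1, aux_eq k hk, Real.exp_le_exp]
    have hf : Real.log ((k+1).factorial : ℝ) = Real.log (k+1) + Real.log (k.factorial : ℝ) := by
      rw [Nat.factorial_succ, Nat.cast_mul, Real.log_mul (by positivity) (by positivity)]
      push_cast; rfl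
    rw [hf]
    have hD := aux_D k hk
    have e : Real.log (k.factorial : ℝ) / k - Real.log k -
        ((Real.log (k+1) + Real.log (k.factorial : ℝ)) / (k+1) - Real.log (k+1)) =
        (Real.log (k.factorial : ℝ) + (k:ℝ)^2 * Real.log (k+1) - k * (k+1) * Real.log k)
          / (k * (k+1)) := by
      field_simp; ring
    have := div_nonneg hD (by positivity : (0:ℝ) ≤ k * (k+1))
    linarith
  · have hs : Tendsto (fun k : ℕ => Real.log (Stirling.stirlingSeq k) / (k:ℝ)) atTop (nhds 0) :=
      (Stirling.tendsto_stirlingSeq_sqrt_pi.log (by positivity)).div_atTop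
        tendsto_natCast_atTop_atTop
    have hl : Tendsto (fun k : ℕ => Real.log (2 * (k:ℝ)) / (2 * (k:ℝ))) atTop (nhds 0) := by
      have h0 : Tendsto (fun x : ℝ => Real.log x / x) atTop (nhds 0) :=
        Real.isLittleO_log_id_atTop.tendsto_div_nhds_zero
      exact h0.comp (tendsto_natCast_atTop_atTop.const_mul_atTop (by norm_num : (0:ℝ) < 2))
    have hm : Tendsto (fun k : ℕ => Real.exp ((-1 + Real.log (Stirling.stirlingSeq k) / (k:ℝ)
        + Real.log (2 * (k:ℝ)) / (2 * (k:ℝ))) / 2)) atTop (nhds (Real.exp ((-1 + 0 + 0) / 2))) :=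
      (Real.continuous_exp.tendsto _).comp (((hs.const_add (-1)).add hl).div_const 2)
    have e : 1 / Real.sqrt (Real.exp 1) = Real.exp ((-1 + 0 + 0) / 2) := by
      rw [← Real.exp_half, one_div, ← Real.exp_neg]; congr 1; norm_num
    rw [e]
    refine hm.congr' ?_
    filter_upwards [eventually_ge_atTop 1] with k hk
    have hk0 : (0:ℝ) < k := by exact_mod_cast hk
    rw [aux_eq k hk, Stirling.log_stirlingSeq_formula, Real.log_div hk0.ne' (Real.exp_ne_zero _),
      Real.log_exp]
    congr 1
    field_simp
    ring
end

section
/- The sequence (b_k)_{k≥2} defined by b_k := ((2k)!/k!)^{1/(2k)} / √(2k) is monotone decreasing (b_{k+1} ≤ b_k for all k ≥ 2) and converges to √(2/e), i.e. lim_{k→∞} ((2k)!/k!)^{1/(2k)} / √(2k) = √(2/e). -/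
open Filter

noncomputable def ff (x : ℝ) : ℝ :=
  Real.log (2 * x + 1) + x * Real.log x - (x + 1) * Real.log (x + 1)

noncomputable def LL (k : ℕ) : ℝ :=
  Real.log (((2 * k).factorial : ℝ) / (k.factorial : ℝ)) - k * Real.log (2 * k)

lemma ff_anti : AntitoneOn ff (Set.Ici 0) := by
  have hd : ∀ x : ℝ, 0 < x →
      HasDerivAt ff (2 / (2 * x + 1) + Real.log x - Real.log (x + 1)) x := by
    intro x hx
    have h1 : HasDerivAt (fun x : ℝ => 2 * x + 1) 2 x := by
      simpa using ((hasDerivAt_id x).const_mul 2).add_const 1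
    have h2 : HasDerivAt (fun x : ℝ => x + 1) 1 x := (hasDerivAt_id x).add_const 1
    have h3 := h1.log (by positivity)
    have h4 := (hasDerivAt_id x).mul (Real.hasDerivAt_log hx.ne')
    have h5 := h2.mul (h2.log (by positivity))
    refine ((h3.add h4).sub h5).congr_deriv ?_
    simp only [id]
    field_simp
    ring
  apply antitoneOn_of_deriv_nonpos (convex_Ici 0)
  · have hc : ContinuousOn (fun x : ℝ => Real.log (2 * x + 1)) (Set.Ici 0) :=
      ContinuousOn.log (by fun_prop) (fun x hx => by
        have : (0:ℝ) ≤ x := hx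
        positivity)
    have hc2 : Continuous (fun x : ℝ => (x + 1) * Real.log (x + 1)) :=
      Real.continuous_mul_log.comp (continuous_id.add continuous_const)
    exact (hc.add Real.continuous_mul_log.continuousOn).sub hc2.continuousOn
  · intro x hx
    rw [interior_Ici] at hx
    exact (hd x hx).differentiableAt.differentiableWithinAt
  · intro x hx
    rw [interior_Ici] at hx
    have hx : 0 < x := hx
    rw [(hd x hx).deriv]
    have h := Real.le_log_one_add_of_nonneg (x := 1 / x) (by positivity)
    have e1 : 2 * (1 / x) / (1 / x + 2) = 2 / (2 * x + 1) := by
      field_simp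
      ring
    have e2 : Real.log (1 + 1 / x) = Real.log (x + 1) - Real.log x := by
      rw [← Real.log_div (by positivity) (by positivity)]
      congr 1
      field_simp
    rw [e1, e2] at h
    linarith

lemma LL_succ (k : ℕ) : LL (k + 1) - LL k = ff k := by
  unfold LL ff
  have e : (((2 * (k + 1)).factorial : ℝ) / ((k + 1).factorial : ℝ))
      = 2 * ((2 * k + 1) * (((2 * k).factorial : ℝ) / (k.factorial : ℝ))) := by
    rw [show 2 * (k + 1) = 2 * k + 1 + 1 by ring]
    simp only [Nat.factorial_succ]
    push_cast
    field_simp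
    ring
  have hk : (k : ℝ) * Real.log (2 * k) = k * Real.log 2 + k * Real.log k := by
    rcases Nat.eq_zero_or_pos k with h | h
    · simp [h]
    · have : (0:ℝ) < k := by exact_mod_cast h
      rw [Real.log_mul (by norm_num) this.ne']
      ring
  rw [e, hk, Real.log_mul (by norm_num) (by positivity),
    Real.log_mul (by positivity) (by positivity)]
  push_cast
  rw [Real.log_mul (by norm_num) (by positivity)]
  ring

lemma LL_sum (k : ℕ) : LL k = ∑ i ∈ Finset.range k, ff i := by
  have h := Finset.sum_range_sub LL k
  simp only [LL_succ] at h
  rw [h]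
  simp [LL]

lemma LL_ge (k : ℕ) : k * ff k ≤ LL k := by
  rw [LL_sum]
  have := Finset.card_nsmul_le_sum (Finset.range k) (fun i : ℕ => ff i) (ff k) (by
    intro i hi
    have hi := Finset.mem_range.1 hi
    exact ff_anti (Set.mem_Ici.2 (by positivity)) (Set.mem_Ici.2 (by positivity))
      (by exact_mod_cast hi.le))
  simpa using this

lemma bb_eq (k : ℕ) (hk : 0 < k) :
    (((2 * k).factorial : ℝ) / (k.factorial : ℝ)) ^ ((1 : ℝ) / (2 * k)) /
            Real.sqrt (2 * k) = Real.exp (LL k / k / 2) := by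
  have : (0:ℝ) < k := by exact_mod_cast hk
  rw [Real.rpow_def_of_pos (by positivity), ← Real.exp_log (x := Real.sqrt (2 * k)) (by positivity),
    ← Real.exp_sub, Real.log_sqrt (by positivity)]
  congr 1
  unfold LL
  field_simp

lemma ff_lim : Tendsto (fun k : ℕ => ff k) atTop (nhds (Real.log 2 - 1)) := by
  have h1 := (Real.tendsto_mul_log_one_add_div_atTop 1).comp (tendsto_natCast_atTop_atTop (R := ℝ))
  have h2 : Tendsto (fun k : ℕ => Real.log (2 - 1 / ((k : ℝ) + 1))) atTop (nhds (Real.log 2)) := by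
    have := (tendsto_one_div_add_atTop_nhds_zero_nat (𝕜 := ℝ)).const_sub 2
    rw [sub_zero] at this
    exact this.log (by norm_num)
  refine (h2.sub h1).congr' ?_
  filter_upwards [eventually_gt_atTop 0] with k hk
  have : (0:ℝ) < k := by exact_mod_cast hk
  have e1 : (2:ℝ) - 1 / ((k : ℝ) + 1) = (2 * k + 1) / (k + 1) := by
    field_simp
    ring
  have e2 : (1:ℝ) + 1 / (k : ℝ) = (k + 1) / k := by
    field_simp
  simp only [Function.comp, ff]
  rw [e1, e2, Real.log_div (by positivity) (by positivity),
    Real.log_div (by positivity) (by positivity)]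
  ring

/-- The sequence `b_k = ((2k)!/k!)^{1/(2k)} / √(2k)` is monotone decreasing for
`k ≥ 2` and converges to `√(2/e)`. -/
theorem double_factorial_ratio_root_antitone_limit :
    (∀ k : ℕ, 2 ≤ k →
        ((((2 * (k + 1)).factorial : ℝ) / ((k + 1).factorial : ℝ)) ^
            ((1 : ℝ) / (2 * (k + 1))) / Real.sqrt (2 * (k + 1))) ≤
          ((((2 * k).factorial : ℝ) / (k.factorial : ℝ)) ^ ((1 : ℝ) / (2 * k)) /
            Real.sqrt (2 * k))) ∧
    Tendsto
      (fun k : ℕ =>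
        (((2 * k).factorial : ℝ) / (k.factorial : ℝ)) ^ ((1 : ℝ) / (2 * k)) /
          Real.sqrt (2 * k))
      atTop (nhds (Real.sqrt (2 / Real.exp 1))) := by
  constructor
  · intro k hk
    have h1 := bb_eq (k + 1) (by omega)
    push_cast at h1
    rw [h1, bb_eq k (by omega)]
    apply Real.exp_le_exp.2
    apply div_le_div_of_nonneg_right _ (by norm_num)
    have hk0 : (0:ℝ) < k := by
      have : 0 < k := by omega
      exact_mod_cast this
    rw [div_le_div_iff₀ (by positivity) hk0]
    have h2 := LL_succ k
    have h3 := LL_ge k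
    have h4 : LL (k + 1) = LL k + ff k := by linarith
    rw [h4]
    nlinarith
  · have h1 : Tendsto (fun k : ℕ => Real.exp (LL k / k / 2)) atTop
        (nhds (Real.exp ((Real.log 2 - 1) / 2))) := by
      apply (Real.continuous_exp.tendsto _).comp
      apply Tendsto.div_const
      refine ff_lim.cesaro.congr ?_
      intro k
      rw [LL_sum]
      ring
    have e : Real.sqrt (2 / Real.exp 1) = Real.exp ((Real.log 2 - 1) / 2) := by
      rw [Real.exp_half, Real.exp_sub, Real.exp_log (by norm_num)]
    rw [e]
    refine h1.congr' ?_
    filter_upwards [eventually_gt_atTop 0] with k hk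
    exact (bb_eq k hk).symm
end

section
/- Let H ⊆ ℝ² be the regular hexagon inscribed in the unit circle, i.e. the convex hull of the six points (cos(jπ/3), sin(jπ/3)) for j = 0, 1, …, 5. Then ∫_H (x² + y²)^{3/2} dx dy = (3√3/640)·(27·log 3 + 68). -/
open MeasureTheory Real

def hexS : Set (ℝ × ℝ) := {p | |2 * (p.2 / √3)| ≤ 1 ∧ |p.1 - p.2 / √3| ≤ 1 ∧ |p.1 + p.2 / √3| ≤ 1}

lemma convex_abs_le (f : ℝ × ℝ →ₗ[ℝ] ℝ) : Convex ℝ {p | |f p| ≤ 1} := by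
  have : {p | |f p| ≤ 1} = f ⁻¹' (Set.Icc (-1) 1) := by ext p; simp [abs_le]
  rw [this]; exact (convex_Icc _ _).linear_preimage f

lemma hexS_convex : Convex ℝ hexS := by
  have h1 := convex_abs_le ((2 / √3) • LinearMap.snd ℝ ℝ ℝ)
  have h2 := convex_abs_le (LinearMap.fst ℝ ℝ ℝ - (1 / √3) • LinearMap.snd ℝ ℝ ℝ)
  have h3 := convex_abs_le (LinearMap.fst ℝ ℝ ℝ + (1 / √3) • LinearMap.snd ℝ ℝ ℝ)
  convert h1.inter (h2.inter h3) using 1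
  ext p
  simp only [hexS, Set.mem_ofPred_eq, Set.mem_inter_iff, LinearMap.smul_apply, LinearMap.sub_apply, LinearMap.add_apply,
    LinearMap.fst_apply, LinearMap.snd_apply, smul_eq_mul]
  ring_nf

lemma verts : (fun j : Fin 6 =>
          ((Real.cos ((j : ℕ) * Real.pi / 3), Real.sin ((j : ℕ) * Real.pi / 3)) : ℝ × ℝ)) =
    ![(1, 0), (1/2, √3/2), (-1/2, √3/2), (-1, 0), (-1/2, -√3/2), (1/2, -√3/2)] := by
  have e2 : 2 * π / 3 = π - π/3 := by ring
  have e3 : 3 * π / 3 = π := by ring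
  have e4 : 4 * π / 3 = π/3 + π := by ring
  have e5 : 5 * π / 3 = 2 * π - π/3 := by ring
  funext j
  fin_cases j <;> simp [e2, e3, e4, e5, cos_pi_sub, cos_add_pi, sin_add_pi, cos_two_pi_sub, sin_two_pi_sub] <;> ring_nf <;> trivial

lemma combo {C : Set (ℝ × ℝ)} (hC : Convex ℝ C) {v w p : ℝ × ℝ} (h0 : (0 : ℝ × ℝ) ∈ C) (hv : v ∈ C) (hw : w ∈ C)
    (a b : ℝ) (ha : 0 ≤ a) (hb : 0 ≤ b) (hab : a + b ≤ 1) (h1 : p.1 = a * v.1 + b * w.1)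
    (h2 : p.2 = a * v.2 + b * w.2) : p ∈ C := by
  have hp : p = a • v + b • w := by
    ext <;> simp [h1, h2]
  rcases eq_or_lt_of_le (add_nonneg ha hb) with h | h
  · have h3 : a = 0 := by linarith
    have h4 : b = 0 := by linarith
    rw [hp, h3, h4]
    simpa using h0
  · have := hC.smul_mem_of_zero_mem h0 (hC hv hw (a := a/(a+b)) (b := b/(a+b)) (by positivity) (by positivity) (by field_simp)) (t := a + b) ⟨h.le, hab⟩
    rw [hp]
    convert this using 1
    rw [smul_add, smul_smul, smul_smul, mul_div_cancel₀ _ h.ne', mul_div_cancel₀ _ h.ne']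

lemma hull_eq : convexHull ℝ (Set.range fun j : Fin 6 =>
          ((Real.cos ((j : ℕ) * Real.pi / 3), Real.sin ((j : ℕ) * Real.pi / 3)) : ℝ × ℝ)) = hexS := by
  rw [verts]
  have hs : 0 < √3 := by positivity
  apply subset_antisymm
  · apply convexHull_min _ hexS_convex
    rintro _ ⟨j, rfl⟩
    have k1 : √3 / 2 / √3 = 1/2 := by field_simp
    have k2 : -√3 / 2 / √3 = -1/2 := by field_simp
    fin_cases j <;> simp [hexS, k1, k2] <;> norm_num [abs_le]
  · rintro ⟨x, y⟩ ⟨h1, h2, h3⟩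
    set C := convexHull ℝ (Set.range (![(1, 0), (1/2, √3/2), (-1/2, √3/2), (-1, 0), (-1/2, -√3/2), (1/2, -√3/2)] : Fin 6 → ℝ × ℝ)) with hCdef
    have hC : Convex ℝ C := convex_convexHull _ _
    have m (j) := subset_convexHull ℝ _ (Set.mem_range_self (f := (![(1, 0), (1/2, √3/2), (-1/2, √3/2), (-1, 0), (-1/2, -√3/2), (1/2, -√3/2)] : Fin 6 → ℝ × ℝ)) j)
    have m0 : ((1, 0) : ℝ × ℝ) ∈ C := m 0
    have m1 : ((1/2, √3/2) : ℝ × ℝ) ∈ C := m 1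
    have m2 : ((-1/2, √3/2) : ℝ × ℝ) ∈ C := m 2
    have m3 : ((-1, 0) : ℝ × ℝ) ∈ C := m 3
    have m4 : ((-1/2, -√3/2) : ℝ × ℝ) ∈ C := m 4
    have m5 : ((1/2, -√3/2) : ℝ × ℝ) ∈ C := m 5
    have hz : (0 : ℝ × ℝ) ∈ C := by
      convert hC m0 m3 (a := 1/2) (b := 1/2) (by norm_num) (by norm_num) (by norm_num) using 1
      ext <;> simp
    obtain ⟨u, rfl⟩ : ∃ u, y = √3 * u := ⟨y / √3, by field_simp⟩
    simp only [mul_div_cancel_left₀ _ hs.ne', abs_le] at h1 h2 h3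
    rcases le_total 0 u with c1 | c1 <;> rcases le_total 0 (x - u) with c2 | c2 <;>
      rcases le_total 0 (x + u) with c3 | c3
    · exact combo hC hz m0 m1 (x - u) (2*u) (by linarith) (by linarith) (by linarith) (by simp; ring) (by simp; ring)
    · exact combo hC hz m0 m1 (x - u) (2*u) (by linarith) (by linarith) (by linarith) (by simp; ring) (by simp; ring)
    · exact combo hC hz m1 m2 (x + u) (u-x) (by linarith) (by linarith) (by linarith) (by simp; ring) (by simp; ring)
    · exact combo hC hz m2 m3 (2*u) (-u-x) (by linarith) (by linarith) (by linarith) (by simp; ring) (by simp; ring)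
    · exact combo hC hz m0 m5 (x+u) (-2*u) (by linarith) (by linarith) (by linarith) (by simp; ring) (by simp; ring)
    · exact combo hC hz m5 m4 (x-u) (-u-x) (by linarith) (by linarith) (by linarith) (by simp; ring) (by simp; ring)
    · exact combo hC hz m3 m4 (u-x) (-2*u) (by linarith) (by linarith) (by linarith) (by simp; ring) (by simp; ring)
    · exact combo hC hz m3 m4 (u-x) (-2*u) (by linarith) (by linarith) (by linarith) (by simp; ring) (by simp; ring)

lemma sec5 (t : ℝ) (ht : 0 < cos t) : HasDerivAt (fun t => sin t / (4 * cos t ^ 4) + 3 * sin t / (8 * cos t ^ 2)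
    + 3 / 8 * (log (1 + sin t) - log (cos t))) ((cos t)⁻¹ ^ 5) t := by
  have hs : 0 < 1 + sin t := by
    have := sin_sq_add_cos_sq t
    nlinarith
  have h1 := (hasDerivAt_sin t).div (((hasDerivAt_cos t).pow 4).const_mul 4) (by simp [ht.ne'])
  have h2 := ((hasDerivAt_sin t).const_mul 3).div (((hasDerivAt_cos t).pow 2).const_mul 8) (by simp [ht.ne'])
  have h3 := (((hasDerivAt_sin t).const_add 1).log hs.ne').sub ((hasDerivAt_cos t).log ht.ne')
  refine ((h1.add h2).add (h3.const_mul (3/8))).congr_deriv ?_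
  have h5 : cos t / (1 + sin t) - -sin t / cos t = 1 / cos t := by
    field_simp
    have := sin_sq_add_cos_sq t
    nlinarith
  rw [h5]
  have h6 : sin t ^ 2 = 1 - cos t ^ 2 := by rw [← sin_sq_add_cos_sq t]; ring
  simp only [Pi.pow_apply]
  norm_num
  field_simp
  ring_nf
  simp only [h6]
  ring

noncomputable def hexM (t : ℝ) : ℝ := max (max |2 * (sin t / √3)| |cos t - sin t / √3|) |cos t + sin t / √3|

lemma hexM_cont : Continuous hexM := by
  unfold hexM; fun_prop

lemma hexM_low (t : ℝ) : 1 / 2 ≤ hexM t := by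
  by_contra! h
  have hs : √3 ^ 2 = 3 := by norm_num
  unfold hexM at h
  rw [max_lt_iff, max_lt_iff] at h
  obtain ⟨⟨h1, h2⟩, h3⟩ := h
  rw [abs_lt] at h1 h2 h3
  have : sin t = √3 * (sin t / √3) := by field_simp
  have h5 := sin_sq_add_cos_sq t
  rw [this] at h5
  generalize cos t = x at *
  generalize sin t / √3 = u at *
  rw [mul_pow, hs] at h5
  have : x^2 ≤ 1/4 := by nlinarith
  have : u^2 ≤ 1/16 := by nlinarith
  linarith

lemma hexM_pos (t : ℝ) : 0 < hexM t := by linarith [hexM_low t]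

lemma hexM_per : Function.Periodic hexM (π / 3) := by
  intro t
  have hs : √3 ^ 2 = 3 := by norm_num
  unfold hexM
  rw [sin_add, cos_add, cos_pi_div_three, sin_pi_div_three]
  have e1 : 2 * ((sin t * (1/2) + cos t * (√3/2)) / √3) = cos t + sin t / √3 := by
    field_simp; ring
  have e2 : cos t * (1/2) - sin t * (√3/2) - ((sin t * (1/2) + cos t * (√3/2)) / √3) = - (2 * (sin t / √3)) := by
    field_simp; ring_nf; rw [hs]; ring
  have e3 : cos t * (1/2) - sin t * (√3/2) + ((sin t * (1/2) + cos t * (√3/2)) / √3) = cos t - sin t / √3 := by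
    field_simp; ring_nf; rw [hs]; ring
  rw [e1, e2, e3, abs_neg, max_comm |cos t + sin t / √3|, max_assoc, max_assoc, max_comm |cos t + sin t / √3|]

lemma hexM_eq (t : ℝ) (h0 : 0 ≤ t) (h1 : t ≤ π / 3) : hexM t = 2 / √3 * cos (t - π / 6) := by
  have hs : √3 ^ 2 = 3 := by norm_num
  have e : 2 / √3 * cos (t - π / 6) = cos t + sin t / √3 := by
    rw [cos_sub, cos_pi_div_six, sin_pi_div_six]; field_simp
  have hsin : 0 ≤ sin t := sin_nonneg_of_nonneg_of_le_pi h0 (by linarith [pi_pos])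
  have hu : 0 ≤ sin t / √3 := by positivity
  have h2 : 0 ≤ cos t - sin t / √3 := by
    have : 0 ≤ sin (π/3 - t) := sin_nonneg_of_nonneg_of_le_pi (by linarith) (by linarith [pi_pos])
    rw [sin_sub, cos_pi_div_three, sin_pi_div_three] at this
    have : cos t - sin t / √3 = (2 / √3) * (√3 / 2 * cos t - 1 / 2 * sin t) := by field_simp
    rw [this]; positivity
  rw [e]
  unfold hexM
  rw [abs_of_nonneg (by positivity), abs_of_nonneg h2, abs_of_nonneg (by linarith)]
  rw [max_eq_right]
  rw [max_le_iff]; constructor <;> linarith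

lemma int_theta : ∫ t in (-π)..π, (hexM t)⁻¹ ^ 5 / 5 = 3 * Real.sqrt 3 / 640 * (27 * Real.log 3 + 68) := by
  have hs : √3 ^ 2 = 3 := by norm_num
  have hc : Continuous fun t => (hexM t)⁻¹ ^ 5 / 5 :=
    ((hexM_cont.inv₀ fun t => (hexM_pos t).ne').pow 5).div_const 5
  have hp : Function.Periodic (fun t => (hexM t)⁻¹ ^ 5 / 5) (π/3) := fun t => by
    simp only [hexM_per t]
  have := hp.intervalIntegral_add_zsmul_eq 6 (-π) (fun _ _ => hc.intervalIntegrable _ _)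
  rw [show -π + (6:ℤ) • (π/3) = π by simp; ring] at this
  rw [this, hp.intervalIntegral_add_eq (-π) 0]
  have e : ∫ t in (0:ℝ)..(0 + π/3), (hexM t)⁻¹ ^ 5 / 5 = ∫ t in (0:ℝ)..(0 + π/3), (√3/2)^5/5 * (cos (t - π/6))⁻¹ ^ 5 := by
    apply intervalIntegral.integral_congr
    intro t ht
    rw [Set.uIcc_of_le (by linarith [pi_pos])] at ht
    simp only [hexM_eq t ht.1 (by linarith [ht.2])]
    rw [mul_inv, inv_div]; ring
  rw [e, intervalIntegral.integral_const_mul, intervalIntegral.integral_comp_sub_right (fun t => (cos t)⁻¹ ^ 5)]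
  have hpos : ∀ t ∈ Set.uIcc (0 - π/6) (0 + π/3 - π/6), 0 < cos t := by
    intro t ht
    rw [Set.uIcc_of_le (by linarith [pi_pos])] at ht
    apply cos_pos_of_mem_Ioo
    constructor <;> linarith [pi_pos, ht.1, ht.2]
  rw [intervalIntegral.integral_eq_sub_of_hasDerivAt (fun t ht => sec5 t (hpos t ht))]
  · rw [show 0 + π/3 - π/6 = π/6 by ring, show 0 - π/6 = -(π/6) by ring]
    simp only [sin_neg, cos_neg, sin_pi_div_six, cos_pi_div_six]
    rw [show (1:ℝ) + 1/2 = 3 * (1/2) by norm_num, show (1:ℝ) + -(1/2) = 1/2 by norm_num, log_mul (by norm_num) (by norm_num)]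
    have h4 : √3 ^ 4 = 9 := by rw [show √3 ^ 4 = (√3^2)^2 by ring, hs]; norm_num
    have h5 : √3 ^ 5 = 9 * √3 := by rw [show √3 ^ 5 = (√3^2)^2 * √3 by ring, hs]; norm_num
    simp only [div_pow, hs, h4, h5]
    simp only [zsmul_eq_mul]
    push_cast
    ring
  · apply ContinuousOn.intervalIntegrable
    exact (continuous_cos.continuousOn.inv₀ fun t ht => (hpos t ht).ne').pow 5

lemma mem_polar (r t : ℝ) (hr : 0 < r) : ((r * cos t, r * sin t) : ℝ × ℝ) ∈ hexS ↔ r ≤ (hexM t)⁻¹ := by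
  rw [le_inv_comm₀ hr (hexM_pos t)]
  unfold hexM hexS
  simp only [Set.mem_ofPred_eq, max_le_iff]
  rw [show 2 * (r * sin t / √3) = r * (2 * (sin t / √3)) by ring,
    show r * cos t - r * sin t / √3 = r * (cos t - sin t / √3) by ring,
    show r * cos t + r * sin t / √3 = r * (cos t + sin t / √3) by ring]
  simp only [abs_mul r, abs_of_pos hr, inv_eq_one_div, le_div_iff₀' hr, and_assoc]

lemma hexS_meas : MeasurableSet hexS := by
  unfold hexS
  apply IsClosed.measurableSet
  have h1 : IsClosed {p : ℝ × ℝ | |2 * (p.2 / √3)| ≤ 1} := isClosed_le (by fun_prop) (by fun_prop)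
  have h2 : IsClosed {p : ℝ × ℝ | |p.1 - p.2 / √3| ≤ 1} := isClosed_le (by fun_prop) (by fun_prop)
  have h3 : IsClosed {p : ℝ × ℝ | |p.1 + p.2 / √3| ≤ 1} := isClosed_le (by fun_prop) (by fun_prop)
  exact h1.inter (h2.inter h3)

lemma hex_main : ∫ p in hexS, (p.1 ^ 2 + p.2 ^ 2) ^ ((3 : ℝ) / 2) = ∫ t in (-π)..π, (hexM t)⁻¹ ^ 5 / 5 := by
  rw [← integral_indicator hexS_meas, ← integral_comp_polarCoord_symm, polarCoord_target]
  set A : Set (ℝ × ℝ) := {q | q.1 ≤ (hexM q.2)⁻¹} with hA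
  have hMc : Continuous fun t => (hexM t)⁻¹ := hexM_cont.inv₀ fun t => (hexM_pos t).ne'
  have hAm : MeasurableSet A :=
    (isClosed_le continuous_fst (hMc.comp continuous_snd)).measurableSet
  have hT : MeasurableSet (Set.Ioi (0:ℝ) ×ˢ Set.Ioo (-π) π) := measurableSet_Ioi.prod measurableSet_Ioo
  have e1 : ∀ q ∈ Set.Ioi (0:ℝ) ×ˢ Set.Ioo (-π) π,
      q.1 • hexS.indicator (fun p : ℝ × ℝ => (p.1 ^ 2 + p.2 ^ 2) ^ ((3 : ℝ) / 2)) (polarCoord.symm q)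
        = A.indicator (fun q => q.1 ^ 4) q := by
    rintro ⟨r, t⟩ ⟨hr, -⟩
    simp only [Set.mem_Ioi] at hr
    have hm := mem_polar r t hr
    rw [polarCoord_symm_apply]
    by_cases h : r ≤ (hexM t)⁻¹
    · rw [Set.indicator_of_mem (hm.2 h), Set.indicator_of_mem (show (r, t) ∈ A from h)]
      simp only [smul_eq_mul]
      rw [show (r * cos t)^2 + (r * sin t)^2 = r ^ 2 by
        rw [mul_pow, mul_pow, ← mul_add, cos_sq_add_sin_sq, mul_one], ← rpow_natCast r 2, ← rpow_mul hr.le]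
      norm_num
      ring
    · rw [Set.indicator_of_notMem (fun h' => h (hm.1 h')), Set.indicator_of_notMem (show (r, t) ∉ A from h), smul_zero]
  rw [setIntegral_congr_fun hT e1]
  have hint : IntegrableOn (A.indicator (fun q : ℝ × ℝ => q.1 ^ 4)) (Set.Ioi (0:ℝ) ×ˢ Set.Ioo (-π) π) := by
    rw [integrableOn_indicator_iff hAm]
    apply IntegrableOn.mono_set (t := Set.Icc (0:ℝ) 2 ×ˢ Set.Icc (-π) π)
    · exact ContinuousOn.integrableOn_compact (isCompact_Icc.prod isCompact_Icc) (by fun_prop)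
    · rintro ⟨r, t⟩ ⟨h1, h2, h3⟩
      refine ⟨⟨le_of_lt h2, ?_⟩, Set.Ioo_subset_Icc_self h3⟩
      have h1 : r ≤ (hexM t)⁻¹ := h1
      refine h1.trans ?_
      rw [inv_le_comm₀ (hexM_pos t) (by norm_num)]
      linarith [hexM_low t]
  rw [IntegrableOn, Measure.volume_eq_prod, ← Measure.prod_restrict] at hint
  rw [Measure.volume_eq_prod, ← Measure.prod_restrict, integral_prod_symm _ hint,
    intervalIntegral.integral_of_le (by linarith [pi_pos]), integral_Ioc_eq_integral_Ioo]
  congr 1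
  funext t
  have hpos : 0 < (hexM t)⁻¹ := inv_pos.2 (hexM_pos t)
  have e2 : (fun r => A.indicator (fun q : ℝ × ℝ => q.1 ^ 4) (r, t)) = (Set.Iic (hexM t)⁻¹).indicator (fun r => r ^ 4) := by
    funext r
    rfl
  rw [e2, setIntegral_indicator measurableSet_Iic, Set.Ioi_inter_Iic, ← intervalIntegral.integral_of_le hpos.le, integral_pow]
  norm_num



/-- For the regular hexagon `H ⊆ ℝ²` inscribed in the unit circle (convex hull of the
six points `(cos(jπ/3), sin(jπ/3))`, `j = 0,…,5`), one has
`∫_H (x² + y²)^{3/2} dx dy = (3√3/640)·(27·log 3 + 68)`. -/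
theorem integral_cube_dist_hexagon :
    ∫ p in convexHull ℝ
        (Set.range fun j : Fin 6 =>
          ((Real.cos ((j : ℕ) * Real.pi / 3), Real.sin ((j : ℕ) * Real.pi / 3)) : ℝ × ℝ)),
      (p.1 ^ 2 + p.2 ^ 2) ^ ((3 : ℝ) / 2) =
      3 * Real.sqrt 3 / 640 * (27 * Real.log 3 + 68) := by
  rw [hull_eq, hex_main, int_theta]
end
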